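/- In the main setup below, u_ε → u uniformly on every compact subset of [0,T] \ {t₁,…,t_{k−1}} as ε → 0. -/

import Mathlib

open Set Filter Topology
open scoped RealInnerProductSpace

/-- The set of pairs `(t, ξ)` with `t ∈ [0,T]` such that `ξ` is a degenerate critical
point of `f t`. -/
noncomputable def degenerateCriticalSet {n : ℕ} (T : ℝ)
    (f : ℝ → EuclideanSpace ℝ (Fin n) → ℝ) :
    Set (ℝ × EuclideanSpace ℝ (Fin n)) :=
  {p | p.1 ∈ Set.Icc 0 T ∧ gradient (f p.1) p.2 = 0 ∧
    LinearMap.det ((fderiv ℝ (gradient (f p.1)) p.2 :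
      EuclideanSpace ℝ (Fin n) →L[ℝ] EuclideanSpace ℝ (Fin n)) :
      EuclideanSpace ℝ (Fin n) →ₗ[ℝ] EuclideanSpace ℝ (Fin n)) = 0}

/-- The Hessian of `f t` at `x` is positive definite. -/
noncomputable def HessPosDef {n : ℕ} (f : ℝ → EuclideanSpace ℝ (Fin n) → ℝ)
    (t : ℝ) (x : EuclideanSpace ℝ (Fin n)) : Prop :=
  ∀ y : EuclideanSpace ℝ (Fin n), y ≠ 0 → 0 < ⟪(fderiv ℝ (gradient (f t)) x) y, y⟫

/-- The Hessian of `f t` at `x` is positive semidefinite. -/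
noncomputable def HessPosSemidef {n : ℕ} (f : ℝ → EuclideanSpace ℝ (Fin n) → ℝ)
    (t : ℝ) (x : EuclideanSpace ℝ (Fin n)) : Prop :=
  ∀ y : EuclideanSpace ℝ (Fin n), 0 ≤ ⟪(fderiv ℝ (gradient (f t)) x) y, y⟫

/-- The gradient with respect to `x` of the partial derivative `f_t`. -/
noncomputable def gradft {n : ℕ} (f : ℝ → EuclideanSpace ℝ (Fin n) → ℝ)
    (t : ℝ) (x : EuclideanSpace ℝ (Fin n)) : EuclideanSpace ℝ (Fin n) :=
  gradient (fun z => deriv (fun s => f s z) t) x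

/-- The third spatial derivative of `f t` at `x` evaluated three times at `ℓ`. -/
noncomputable def thirdDeriv {n : ℕ} (f : ℝ → EuclideanSpace ℝ (Fin n) → ℝ)
    (t : ℝ) (x ℓ : EuclideanSpace ℝ (Fin n)) : ℝ :=
  iteratedFDeriv ℝ 3 (f t) x ![ℓ, ℓ, ℓ]

section Dynamics

variable {E : Type*} [NormedAddCommGroup E] [InnerProductSpace ℝ E]

/-- `U` solves the singularly perturbed system `ε U' = -g(t, U)` on `[0, T]`. -/
def IsFastSol (g : ℝ → E → E) (T ε : ℝ) (U : ℝ → E) : Prop :=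
  ∀ s ∈ Icc (0 : ℝ) T, HasDerivWithinAt U (-(ε⁻¹ • g s (U s))) (Icc 0 T) s

/-- A function whose derivative is at most `-m` wherever it exceeds `c` either ends below `c`
or decreases linearly throughout. -/
lemma le_or_le_sub_of_deriv_le_neg {q q' : ℝ → ℝ} {a b c m : ℝ} (hab : a ≤ b) (hm : 0 < m)
    (hqc : ContinuousOn q (Icc a b))
    (hq : ∀ t ∈ Ico a b, HasDerivWithinAt q (q' t) (Ici t) t)
    (h : ∀ t ∈ Ico a b, c < q t → q' t ≤ -m) :
    q b ≤ c ∨ q b ≤ q a - m * (b - a) := by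
  by_cases hb : q b ≤ c
  · exact Or.inl hb
  right
  push Not at hb
  have key : ∀ s ∈ Icc a b, c < q s := by
    intro s hs
    by_contra hcs
    push Not at hcs
    have := image_le_of_deriv_right_lt_deriv_boundary' (f := q) (f' := q') (a := s) (b := b)
      (B := fun _ => (c + q b) / 2) (B' := fun _ => 0)
      (hqc.mono (Icc_subset_Icc_left hs.1))
      (fun x hx => hq x ⟨hs.1.trans hx.1, hx.2⟩) (by linarith) continuousOn_const
      (fun x _ => hasDerivWithinAt_const _ _ _)
      (fun x hx hqx => by
        have := h x ⟨hs.1.trans hx.1, hx.2⟩ (by linarith)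
        linarith) (right_mem_Icc.2 hs.2)
    linarith
  exact image_le_of_deriv_right_le_deriv_boundary (f := q) (f' := q') (a := a) (b := b)
      (B := fun t => q a - m * (t - a)) (B' := fun _ => -m) hqc hq (by simp)
      (by fun_prop)
      (fun x _ => by
        have := (((hasDerivAt_id x).sub_const a).const_mul m).const_sub (q a)
        simpa using this.hasDerivWithinAt)
      (fun x hx => h x hx (key x ⟨hx.1, hx.2.le⟩)) (right_mem_Icc.2 hab)

variable {g : ℝ → E → E} {T ε : ℝ} {U : ℝ → E}

lemma IsFastSol.continuousOn (h : IsFastSol g T ε U) : ContinuousOn U (Icc 0 T) :=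
  fun s hs => (h s hs).continuousWithinAt

lemma IsFastSol.hasDerivWithinAt_Ici (h : IsFastSol g T ε U) {s : ℝ} (hs : s ∈ Ico (0 : ℝ) T) :
    HasDerivWithinAt U (-(ε⁻¹ • g s (U s))) (Ici s) s :=
  (h s ⟨hs.1, hs.2.le⟩).mono_of_mem_nhdsWithin (Icc_mem_nhdsGE_of_mem hs)

lemma IsFastSol.hasDerivWithinAt_Iic (h : IsFastSol g T ε U) {s : ℝ} (hs : s ∈ Ioc (0 : ℝ) T) :
    HasDerivWithinAt U (-(ε⁻¹ • g s (U s))) (Iic s) s :=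
  (h s ⟨hs.1.le, hs.2⟩).mono_of_mem_nhdsWithin (Icc_mem_nhdsLE_of_mem hs)

/-- A moving ball on whose boundary `g` points outwards traps fast solutions. -/
lemma IsFastSol.norm_sub_le (hU : IsFastSol g T ε U) (hε : 0 < ε) {a b : ℝ} (ha : 0 ≤ a)
    (hb : b ≤ T) {c c' : ℝ → E} {M m ρ : ℝ} (hc : ContinuousOn c (Icc a b))
    (hc' : ∀ s ∈ Ico a b, HasDerivWithinAt c (c' s) (Ici s) s)
    (hM : ∀ s ∈ Ico a b, ‖c' s‖ ≤ M) (hρ : 0 < ρ)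
    (hm : ∀ s ∈ Ico a b, ∀ x, ‖x - c s‖ = ρ → m ≤ ⟪g s x, x - c s⟫)
    (hεm : ε * M * ρ < m) (hstart : ‖U a - c a‖ ≤ ρ) :
    ∀ s ∈ Icc a b, ‖U s - c s‖ ≤ ρ := by
  intro s hs
  have hcont : ContinuousOn (fun s => U s - c s) (Icc a b) :=
    (hU.continuousOn.mono (Icc_subset_Icc ha hb)).sub hc
  have := image_le_of_deriv_right_lt_deriv_boundary' (f := fun s => ‖U s - c s‖ ^ 2)
    (f' := fun s => 2 * ⟪U s - c s, -(ε⁻¹ • g s (U s)) - c' s⟫) (a := a) (b := b)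
    (B := fun _ => ρ ^ 2) (B' := fun _ => 0) (hcont.norm.pow 2)
    (fun s hs => ((hU.hasDerivWithinAt_Ici ⟨ha.trans hs.1, hs.2.trans_le hb⟩).sub
      (hc' s hs)).norm_sq)
    (pow_le_pow_left₀ (norm_nonneg _) hstart 2) continuousOn_const
    (fun x _ => hasDerivWithinAt_const _ _ _)
    (fun s hs hq => by
      have hn : ‖U s - c s‖ = ρ := (pow_left_inj₀ (norm_nonneg _) hρ.le two_ne_zero).1 hq
      have h1 := hm s hs (U s) hn
      have h2 : |⟪U s - c s, c' s⟫| ≤ ρ * M :=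
        (abs_real_inner_le_norm _ _).trans (by
          rw [hn]; exact mul_le_mul_of_nonneg_left (hM s hs) hρ.le)
      have h3 : ⟪U s - c s, -(ε⁻¹ • g s (U s)) - c' s⟫
          = -(ε⁻¹ * ⟪g s (U s), U s - c s⟫) - ⟪U s - c s, c' s⟫ := by
        rw [inner_sub_right, inner_neg_right, inner_smul_right, real_inner_comm]
      have h4 : ρ * M < ε⁻¹ * m := by
        rw [inv_mul_eq_div, lt_div_iff₀ hε]; linarith
      have h5 : ε⁻¹ * m ≤ ε⁻¹ * ⟪g s (U s), U s - c s⟫ :=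
        mul_le_mul_of_nonneg_left h1 (inv_pos.2 hε).le
      have h6 := (abs_le.1 h2).1
      rw [h3]
      linarith) hs
  exact (pow_le_pow_iff_left₀ (norm_nonneg _) hρ.le two_ne_zero).1 this

/-- Coercivity bounds fast solutions uniformly. -/
lemma exists_bound_of_coercive {a₀ c₀ : ℝ} (ha₀ : 0 ≤ a₀) (hc₀ : 0 < c₀)
    (hco : ∀ t ∈ Icc (0 : ℝ) T, ∀ x, c₀ * ‖x‖ ^ 2 - a₀ ≤ ⟪g t x, x⟫) (B : ℝ) :
    ∃ R₀, ∀ R ≥ R₀, ∀ ε > 0, ∀ U, IsFastSol g T ε U → ‖U 0‖ ≤ B →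
      ∀ s ∈ Icc 0 T, U s ∈ Metric.closedBall 0 R := by
  refine ⟨max (max B 1) ((a₀ + 1) / c₀), fun R hR ε hε U hU hU0 s hs => ?_⟩
  have h1 : B ≤ R := (le_max_left _ _).trans ((le_max_left _ _).trans hR)
  have h2 : 1 ≤ R := (le_max_right _ _).trans ((le_max_left _ _).trans hR)
  have h3 : (a₀ + 1) / c₀ ≤ R := (le_max_right _ _).trans hR
  rw [div_le_iff₀ hc₀] at h3
  have := hU.norm_sub_le hε le_rfl le_rfl (c := fun _ => 0) (c' := fun _ => 0) (M := 0) (m := 1)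
    (ρ := R) continuousOn_const (fun s _ => hasDerivWithinAt_const _ _ _) (by simp) (by linarith)
    (fun s hs x hx => by
      rw [sub_zero] at hx ⊢
      have := hco s (Ico_subset_Icc_self hs) x
      rw [hx] at this
      nlinarith) (by simp) (by simpa using hU0.trans h1) s hs
  simpa using this

end Dynamics

section Cone

variable {E : Type*} [NormedAddCommGroup E] [InnerProductSpace ℝ E]

/-- The quadratic form `‖p‖² - κ ⟪p, ℓ⟫²`, which is nonpositive on a cone around `ℓ`. -/
def coneForm (ℓ : E) (κ : ℝ) (p : E) : ℝ := ‖p‖ ^ 2 - κ * ⟪p, ℓ⟫ ^ 2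

lemma continuous_coneForm (ℓ : E) (κ : ℝ) : Continuous (coneForm ℓ κ) := by
  unfold coneForm; fun_prop

lemma coneForm_le_norm_sq {ℓ : E} {κ : ℝ} (hκ : 0 ≤ κ) (p : E) : coneForm ℓ κ p ≤ ‖p‖ ^ 2 := by
  unfold coneForm; nlinarith [mul_nonneg hκ (sq_nonneg ⟪p, ℓ⟫)]

lemma hasDerivWithinAt_coneForm (ℓ : E) (κ : ℝ) {p : ℝ → E} {p' : E} {s : Set ℝ} {t : ℝ}
    (h : HasDerivWithinAt p p' s t) : HasDerivWithinAt (fun t => coneForm ℓ κ (p t))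
      (2 * ⟪p', p t - (κ * ⟪p t, ℓ⟫) • ℓ⟫) s t := by
  have h2 := ((h.inner ℝ (hasDerivWithinAt_const t s ℓ)).pow 2).const_mul κ
  convert! h.norm_sq.sub h2 using 1
  rw [inner_sub_right, inner_smul_right, inner_zero_right, real_inner_comm (p t) p']
  norm_num
  ring

lemma le_inner_add_of_coneForm_nonneg {A : E →L[ℝ] E} {ℓ : E} (hℓ : ‖ℓ‖ = 1) {lam κ : ℝ}
    (hκ : 1 < κ) (hlam : 0 < lam) (hA : ∀ p, lam * (‖p‖ ^ 2 - ⟪p, ℓ⟫ ^ 2) ≤ ⟪A p, p⟫)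
    (hAℓ : ∀ p, ⟪A p, ℓ⟫ = 0) {η θ : ℝ} {p e : E} (he : ‖e‖ ≤ η * ‖p‖ + θ)
    (hQ : 0 ≤ coneForm ℓ κ p) :
    (lam * (1 - 1 / κ) - (1 + κ) * η) * ‖p‖ ^ 2 - (1 + κ) * θ * ‖p‖
      ≤ ⟪A p + e, p - (κ * ⟪p, ℓ⟫) • ℓ⟫ := by
  have hz : |⟪p, ℓ⟫| ≤ ‖p‖ := by simpa [hℓ] using abs_real_inner_le_norm p ℓ
  have h1 : ‖p - (κ * ⟪p, ℓ⟫) • ℓ‖ ≤ (1 + κ) * ‖p‖ := by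
    refine (norm_sub_le _ _).trans ?_
    rw [norm_smul, hℓ, Real.norm_eq_abs, abs_mul, abs_of_pos (by linarith : (0 : ℝ) < κ)]
    nlinarith
  have h2 : |⟪e, p - (κ * ⟪p, ℓ⟫) • ℓ⟫| ≤ (η * ‖p‖ + θ) * ((1 + κ) * ‖p‖) :=
    (abs_real_inner_le_norm _ _).trans
      (mul_le_mul he h1 (norm_nonneg _) ((norm_nonneg _).trans he))
  have h3 : ⟪A p, p - (κ * ⟪p, ℓ⟫) • ℓ⟫ = ⟪A p, p⟫ := by
    rw [inner_sub_right, inner_smul_right, hAℓ]; ring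
  have h4 : ‖p‖ ^ 2 * (1 - 1 / κ) ≤ ‖p‖ ^ 2 - ⟪p, ℓ⟫ ^ 2 := by
    unfold coneForm at hQ
    have : ⟪p, ℓ⟫ ^ 2 ≤ ‖p‖ ^ 2 / κ := by rw [le_div_iff₀ (by linarith)]; linarith
    calc ‖p‖ ^ 2 * (1 - 1 / κ) = ‖p‖ ^ 2 - ‖p‖ ^ 2 / κ := by ring
      _ ≤ _ := by linarith
  have h5 := mul_le_mul_of_nonneg_left h4 hlam.le
  rw [inner_add_left, h3]
  nlinarith [hA p, (abs_le.1 h2).1]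

/-- Quantitative consequences of the transversality conditions for the field `g` near a
degenerate equilibrium `ξ` at time `τ`, with kernel direction `ℓ`: outside a cone around `ℓ` the
field is monotone, and inside it the `ℓ`-component of `-g` is driven by a quadratic term and
by a term linear in time. -/
structure SaddleNode (g : ℝ → E → E) (T τ : ℝ) (ξ ℓ : E) (κ r δ₀ c₁ C₁ c C β : ℝ) : Prop where
  norm_eq : ‖ℓ‖ = 1
  one_lt : 1 < κ
  le_two : κ ≤ 2
  r_pos : 0 < r
  δ₀_pos : 0 < δ₀
  c₁_pos : 0 < c₁
  C₁_pos : 0 < C₁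
  c_pos : 0 < c
  C_pos : 0 < C
  β_ne : β ≠ 0
  lt_sub : 0 < τ - δ₀
  add_lt : τ + δ₀ < T
  crit : g τ ξ = 0
  cone : ∀ t, |t - τ| ≤ δ₀ → ∀ x ∈ Metric.closedBall ξ r, ∀ y ∈ Metric.closedBall ξ r,
    0 ≤ coneForm ℓ κ (x - y) → c₁ * ‖x - y‖ ^ 2 - C₁ * |t - τ| * ‖x - y‖
      ≤ ⟪g t x - g τ y, x - y - (κ * ⟪x - y, ℓ⟫) • ℓ⟫
  drift : ∀ t, |t - τ| ≤ δ₀ → ∀ x ∈ Metric.closedBall ξ r, ∀ ρ : ℝ,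
    coneForm ℓ κ (x - ξ) ≤ ρ ^ 2 →
      c * ⟪x - ξ, ℓ⟫ ^ 2 - C * ρ ^ 2 + β * (t - τ) - |β| / 2 * |t - τ| ≤ -⟪g t x, ℓ⟫

variable {g : ℝ → E → E} {T τ : ℝ} {ξ ℓ : E} {κ r δ₀ c₁ C₁ c C β : ℝ}

/-- If the equilibrium is the limit of a branch of equilibria from the left, then the drift in
time points in the direction of the quadratic term. -/
lemma SaddleNode.β_pos (S : SaddleNode g T τ ξ ℓ κ r δ₀ c₁ C₁ c C β) {u : ℝ → E}
    (hu : Tendsto u (𝓝[<] τ) (𝓝 ξ)) (hcrit : ∀ᶠ t in 𝓝[<] τ, g t (u t) = 0) : 0 < β := by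
  by_contra hβ
  have hβ : β < 0 := lt_of_le_of_ne (not_lt.1 hβ) S.β_ne
  have hc₁ := S.c₁_pos
  have hC₁ := S.C₁_pos
  set K := C₁ / c₁ with hK
  have hKpos : 0 < K := div_pos hC₁ hc₁
  have hC := S.C_pos
  have hball : ∀ᶠ t in 𝓝[<] τ, u t ∈ Metric.closedBall ξ r :=
    hu (Metric.closedBall_mem_nhds _ S.r_pos)
  obtain ⟨δ, hδ, hδle⟩ : ∃ δ > 0, δ ≤ δ₀ ∧ C * K ^ 2 * δ < |β| / 2 := by
    refine ⟨min δ₀ (|β| / 2 / (2 * (C * K ^ 2))), ?_, min_le_left _ _, ?_⟩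
    · have := S.δ₀_pos
      have := abs_pos.2 S.β_ne
      positivity
    · have h0 := abs_pos.2 S.β_ne
      calc C * K ^ 2 * min δ₀ (|β| / 2 / (2 * (C * K ^ 2)))
          ≤ C * K ^ 2 * (|β| / 2 / (2 * (C * K ^ 2))) := by
            gcongr; exact min_le_right _ _
        _ = |β| / 4 := by field_simp; norm_num
        _ < |β| / 2 := by linarith
  have hnear : ∀ᶠ t in 𝓝[<] τ, τ - δ < t ∧ t < τ := by
    filter_upwards [Ioo_mem_nhdsLT (show τ - δ < τ by linarith)] with t ht using ht
  obtain ⟨t, h1, h2, h3, h4⟩ := (hcrit.and (hball.and hnear)).exists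
  have habs : |t - τ| = τ - t := by rw [abs_sub_comm, abs_of_pos (by linarith)]
  have htδ : |t - τ| ≤ δ₀ := by rw [habs]; linarith [hδle.1]
  have hQ : coneForm ℓ κ (u t - ξ) ≤ (K * (τ - t)) ^ 2 := by
    by_cases h0 : 0 ≤ coneForm ℓ κ (u t - ξ)
    · have := S.cone t htδ (u t) h2 ξ (Metric.mem_closedBall_self S.r_pos.le) h0
      rw [h1, S.crit, sub_zero, inner_zero_left, habs] at this
      have hle : ‖u t - ξ‖ ≤ K * (τ - t) := by
        rcases (norm_nonneg (u t - ξ)).eq_or_lt with hp | hp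
        · rw [← hp]; exact mul_nonneg hKpos.le (by linarith)
        · have : c₁ * ‖u t - ξ‖ ≤ C₁ * (τ - t) := by
            by_contra hcon
            push Not at hcon
            nlinarith
          rw [hK, div_mul_eq_mul_div, le_div_iff₀ hc₁]
          linarith
      exact (coneForm_le_norm_sq (by linarith [S.one_lt]) _).trans
        (pow_le_pow_left₀ (norm_nonneg _) hle 2)
    · exact (not_le.1 h0).le.trans (sq_nonneg _)
  have := S.drift t htδ (u t) h2 _ hQ
  rw [h1, inner_zero_left, habs] at this
  have hb : |β| = -β := abs_of_neg hβ
  have hpos : 0 < τ - t := by linarith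
  have h5 : C * (K * (τ - t)) ^ 2 < -β / 2 * (τ - t) := by
    have : C * K ^ 2 * (τ - t) < -β / 2 := by
      rw [hb] at hδle
      refine lt_of_le_of_lt ?_ hδle.2
      gcongr
      linarith
    nlinarith
  rw [hb] at this
  nlinarith [mul_nonneg S.c_pos.le (sq_nonneg ⟪u t - ξ, ℓ⟫)]

/-- The cone form of the difference of two trajectories near the equilibrium is small unless it
decreases at a fixed rate. -/
lemma SaddleNode.coneForm_sub_le (S : SaddleNode g T τ ξ ℓ κ r δ₀ c₁ C₁ c C β) {ε : ℝ}
    (hε : 0 < ε) {a b : ℝ} (hab : a ≤ b) {U V : ℝ → E} {θ : ℝ → ℝ}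
    (hUc : ContinuousOn U (Icc a b)) (hVc : ContinuousOn V (Icc a b))
    (hU : ∀ t ∈ Ico a b, HasDerivWithinAt U (-(ε⁻¹ • g (θ t) (U t))) (Ici t) t)
    (hV : ∀ t ∈ Ico a b, HasDerivWithinAt V (-(ε⁻¹ • g τ (V t))) (Ici t) t)
    (hUb : ∀ t ∈ Ico a b, U t ∈ Metric.closedBall ξ r)
    (hVb : ∀ t ∈ Ico a b, V t ∈ Metric.closedBall ξ r) {δ ρ : ℝ}
    (hθ : ∀ t ∈ Ico a b, |θ t - τ| ≤ δ) (hδ : δ ≤ δ₀) (hρ : 0 < ρ)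
    (hδρ : 2 * C₁ * δ ≤ c₁ * ρ) :
    coneForm ℓ κ (U b - V b) ≤ ρ ^ 2 ∨
      coneForm ℓ κ (U b - V b) ≤ coneForm ℓ κ (U a - V a) - ε⁻¹ * (c₁ * ρ ^ 2) * (b - a) := by
  have hc₁ := S.c₁_pos
  have hC₁ := S.C₁_pos
  have hεi : 0 < ε⁻¹ := inv_pos.2 hε
  refine le_or_le_sub_of_deriv_le_neg (q := fun t => coneForm ℓ κ (U t - V t))
    (q' := fun t => -(2 * ε⁻¹) * ⟪g (θ t) (U t) - g τ (V t),
      U t - V t - (κ * ⟪U t - V t, ℓ⟫) • ℓ⟫) hab (by positivity)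
    ((continuous_coneForm ℓ κ).comp_continuousOn (hUc.sub hVc)) ?_ ?_
  · intro t ht
    have hd := (hU t ht).sub (hV t ht)
    convert! hasDerivWithinAt_coneForm ℓ κ hd using 1
    rw [show -(ε⁻¹ • g (θ t) (U t)) - -(ε⁻¹ • g τ (V t))
      = (-ε⁻¹) • (g (θ t) (U t) - g τ (V t)) by module, real_inner_smul_left]
    simp only [Pi.sub_apply]
    ring
  · intro t ht hQ
    have h0 : 0 ≤ coneForm ℓ κ (U t - V t) := (sq_nonneg ρ).trans hQ.le
    have h1 := S.cone (θ t) ((hθ t ht).trans hδ) _ (hUb t ht) _ (hVb t ht) h0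
    have h2 : ρ ^ 2 < ‖U t - V t‖ ^ 2 :=
      hQ.trans_le (coneForm_le_norm_sq (by linarith [S.one_lt]) _)
    have h3 : ρ < ‖U t - V t‖ := (pow_lt_pow_iff_left₀ hρ.le (norm_nonneg _) two_ne_zero).1 h2
    have h4 : C₁ * |θ t - τ| ≤ c₁ * ‖U t - V t‖ / 2 := by nlinarith [hθ t ht]
    have h5 : c₁ * ρ ^ 2 / 2 ≤
        ⟪g (θ t) (U t) - g τ (V t), U t - V t - (κ * ⟪U t - V t, ℓ⟫) • ℓ⟫ := by
      nlinarith [norm_nonneg (U t - V t)]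
    nlinarith

/-- A nonconstant orbit emanating from the equilibrium lies in the cone, on the side of `ℓ`. -/
lemma SaddleNode.orbit_mem_cone (S : SaddleNode g T τ ξ ℓ κ r δ₀ c₁ C₁ c C β) {v : ℝ → E}
    (hv : ∀ s, HasDerivAt v (-g τ (v s)) s) (hlim : Tendsto v atBot (𝓝 ξ)) {s₀ : ℝ}
    (hs₀ : ∀ s ≤ s₀, v s ∈ Metric.closedBall ξ r) (hne : v s₀ ≠ ξ) :
    coneForm ℓ κ (v s₀ - ξ) ≤ 0 ∧ 0 < ⟪v s₀ - ξ, ℓ⟫ := by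
  have hc₁ := S.c₁_pos
  have hvc : Continuous v := continuous_iff_continuousAt.2 fun s => (hv s).continuousAt
  have hξ : ξ ∈ Metric.closedBall ξ r := Metric.mem_closedBall_self S.r_pos.le
  have hcone : ∀ s ≤ s₀, coneForm ℓ κ (v s - ξ) ≤ 0 := by
    intro s hs
    have key : ∀ ρ > 0, coneForm ℓ κ (v s - ξ) ≤ ρ ^ 2 := by
      intro ρ hρ
      set L := r ^ 2 / (c₁ * ρ ^ 2) with hL
      have hLpos : 0 ≤ L := by positivity
      have h1 := S.coneForm_sub_le (ε := 1) one_pos (a := s - L) (b := s) (U := v)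
        (V := fun _ => ξ) (θ := fun _ => τ) (δ := 0) (by linarith) hvc.continuousOn
        continuousOn_const (fun t _ => by simpa using (hv t).hasDerivWithinAt)
        (fun t _ => by simpa [S.crit] using hasDerivWithinAt_const t (Ici t) ξ)
        (fun t ht => hs₀ t (ht.2.le.trans hs)) (fun _ _ => hξ) (fun _ _ => by simp)
        S.δ₀_pos.le hρ (by simp; positivity)
      rcases h1 with h1 | h1
      · exact h1
      · have h2 : coneForm ℓ κ (v (s - L) - ξ) ≤ r ^ 2 :=
          (coneForm_le_norm_sq (by linarith [S.one_lt]) _).trans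
            (pow_le_pow_left₀ (norm_nonneg _)
              (by simpa [dist_eq_norm] using hs₀ (s - L) (by linarith)) 2)
        have h3 : (1 : ℝ)⁻¹ * (c₁ * ρ ^ 2) * (s - (s - L)) = r ^ 2 := by
          rw [hL]; field_simp; ring
        rw [h3] at h1
        nlinarith [sq_nonneg ρ]
    by_contra hcon
    push Not at hcon
    have := key (Real.sqrt (coneForm ℓ κ (v s - ξ) / 2)) (Real.sqrt_pos.2 (by linarith))
    rw [Real.sq_sqrt (by linarith)] at this
    linarith
  refine ⟨hcone s₀ le_rfl, ?_⟩
  have hmono : MonotoneOn (fun s => ⟪v s - ξ, ℓ⟫) (Iic s₀) := by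
    refine monotoneOn_of_hasDerivWithinAt_nonneg (f' := fun s => -⟪g τ (v s), ℓ⟫)
      (convex_Iic _) (by fun_prop) ?_ ?_
    · intro s _
      have := ((hv s).sub_const ξ).inner ℝ (hasDerivAt_const s ℓ)
      simpa using this.hasDerivWithinAt
    · intro s hs
      replace hs : s ≤ s₀ := mem_Iic.1 (interior_subset hs)
      have := S.drift τ (by simpa using S.δ₀_pos.le) (v s) (hs₀ s hs) 0
        (by simpa using hcone s hs)
      simp only [sub_self, abs_zero, mul_zero] at this
      nlinarith [mul_nonneg S.c_pos.le (sq_nonneg ⟪v s - ξ, ℓ⟫)]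
  have hnonneg : 0 ≤ ⟪v s₀ - ξ, ℓ⟫ := by
    have hl : Tendsto (fun s => ⟪v s - ξ, ℓ⟫) atBot (𝓝 ⟪ξ - ξ, ℓ⟫) :=
      (hlim.sub_const ξ).inner tendsto_const_nhds
    rw [sub_self, inner_zero_left] at hl
    exact le_of_tendsto hl ((eventually_le_atBot s₀).mono fun s hs =>
      hmono hs (mem_Iic.2 le_rfl) hs)
  refine lt_of_le_of_ne hnonneg fun h0 => hne ?_
  have := hcone s₀ le_rfl
  unfold coneForm at this
  rw [← h0] at this
  have h2 : ‖v s₀ - ξ‖ = 0 := by nlinarith [norm_nonneg (v s₀ - ξ)]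
  exact sub_eq_zero.1 (norm_eq_zero.1 h2)

end Cone

/-- Either a continuous function stays below `1` or there is a first time at which it equals `1`. -/
lemma forall_lt_one_or_exists_first {m : ℝ → ℝ} {a b : ℝ} (hm : ContinuousOn m (Icc a b))
    (ha : m a < 1) :
    (∀ t ∈ Icc a b, m t < 1) ∨ ∃ t₁ ∈ Ioc a b, m t₁ = 1 ∧ ∀ t ∈ Ico a t₁, m t < 1 := by
  by_cases h : ∀ t ∈ Icc a b, m t < 1
  · exact Or.inl h
  right
  push Not at h
  obtain ⟨t₀, ht₀, hmt₀⟩ := h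
  have hcpt : IsCompact (Icc a b ∩ m ⁻¹' Ici 1) :=
    isCompact_Icc.of_isClosed_subset (hm.preimage_isClosed_of_isClosed isClosed_Icc isClosed_Ici)
      inter_subset_left
  have hmem := hcpt.sInf_mem ⟨t₀, ht₀, hmt₀⟩
  set t₁ := sInf (Icc a b ∩ m ⁻¹' Ici 1) with ht₁
  have hmin : ∀ t ∈ Icc a b, 1 ≤ m t → t₁ ≤ t := fun t ht hmt =>
    csInf_le hcpt.bddBelow ⟨ht, hmt⟩
  obtain ⟨t₂, ht₂, hmt₂⟩ := intermediate_value_Icc hmem.1.1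
    (hm.mono (Icc_subset_Icc_right hmem.1.2)) ⟨ha.le, hmem.2⟩
  have heq : t₂ = t₁ := le_antisymm ht₂.2
    (hmin t₂ ⟨ht₂.1, ht₂.2.trans hmem.1.2⟩ hmt₂.ge)
  rw [heq] at hmt₂
  refine ⟨t₁, ⟨lt_of_le_of_ne hmem.1.1 ?_, hmem.1.2⟩, hmt₂, fun t ht => ?_⟩
  · intro hcon
    rw [← hcon] at hmt₂
    linarith
  · by_contra hcon
    have := hmin t ⟨ht.1, ht.2.le.trans hmem.1.2⟩ (not_lt.1 hcon)
    linarith [ht.2]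

section Jump

variable {E : Type*} [NormedAddCommGroup E] [InnerProductSpace ℝ E]
variable {g : ℝ → E → E} {T τ : ℝ} {ξ ℓ : E} {κ r δ₀ c₁ C₁ c C β : ℝ}

/-- A point at which `h` attains a minimum from the left has nonpositive derivative. -/
lemma hasDerivWithinAt_Iic_nonpos {h : ℝ → ℝ} {h' a t : ℝ} (hat : a < t)
    (hd : HasDerivWithinAt h h' (Iic t) t) (hmin : ∀ s ∈ Ico a t, h t ≤ h s) : h' ≤ 0 := by
  have hs := (hasDerivWithinAt_iff_tendsto_slope' self_notMem_Iio).1 (hd.mono Iio_subset_Iic_self)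
  refine le_of_tendsto hs ?_
  filter_upwards [Ico_mem_nhdsLT hat] with s hs
  rw [slope_def_field]
  exact div_nonpos_of_nonneg_of_nonpos (by linarith [hmin s hs]) (by linarith [hs.2])

/-- A fast solution moves in direction `ℓ` at rate at least `m / ε` while `-⟪g, ℓ⟫ ≥ m`. -/
lemma IsFastSol.inner_growth {ε : ℝ} {U : ℝ → E} (hU : IsFastSol g T ε U) (hε : 0 < ε⁻¹)
    {a b m : ℝ} (ha : 0 ≤ a) (hab : a ≤ b) (hb : b ≤ T) (ξ : E)
    (h : ∀ t ∈ Ico a b, m ≤ -⟪g t (U t), ℓ⟫) :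
    ⟪U a - ξ, ℓ⟫ + ε⁻¹ * m * (b - a) ≤ ⟪U b - ξ, ℓ⟫ := by
  have := image_le_of_deriv_right_le_deriv_boundary (a := a) (b := b)
      (f := fun t => -⟪U t - ξ, ℓ⟫) (f' := fun t => ε⁻¹ * ⟪g t (U t), ℓ⟫)
      (B := fun t => -⟪U a - ξ, ℓ⟫ - ε⁻¹ * m * (t - a)) (B' := fun _ => -(ε⁻¹ * m))
      (by
        have : ContinuousOn U (Icc a b) := hU.continuousOn.mono (Icc_subset_Icc ha hb)
        fun_prop)
      (fun t ht => by
        have h1 := ((hU.hasDerivWithinAt_Ici (s := t)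
          ⟨ha.trans ht.1, ht.2.trans_le hb⟩).sub_const ξ).inner ℝ
            (hasDerivWithinAt_const t (Ici t) ℓ)
        convert! h1.neg using 1
        simp [inner_neg_left, real_inner_smul_left])
      (by simp) (by fun_prop)
      (fun t _ => by
        have := (((hasDerivAt_id t).sub_const a).const_mul (ε⁻¹ * m)).const_sub (-⟪U a - ξ, ℓ⟫)
        simpa using this.hasDerivWithinAt)
      (fun t ht => by nlinarith [h t ht])
      (right_mem_Icc.2 hab)
  linarith

set_option maxHeartbeats 1000000 in
/-- Fast solutions that approach a saddle-node along a stable branch pass close to any given point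
of the orbit emanating from it. -/
theorem SaddleNode.eventually_exists_near_orbit
    (S : SaddleNode g T τ ξ ℓ κ r δ₀ c₁ C₁ c C β) (hβ : 0 < β) {v : ℝ → E}
    (hv : ∀ s, HasDerivAt v (-g τ (v s)) s) (hlim : Tendsto v atBot (𝓝 ξ)) {s₀ : ℝ}
    (hs₀ : ∀ s ≤ s₀, v s ∈ Metric.closedBall ξ (r / 2)) (hne : v s₀ ≠ ξ) {u : ℝ → E}
    (hu : Tendsto u (𝓝[<] τ) (𝓝 ξ)) {uε : ℝ → ℝ → E}
    (hsol : ∀ ε > 0, IsFastSol g T ε (uε ε)) {a₀ : ℝ} (ha₀ : a₀ < τ)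
    (hconv : ∀ a b, a₀ < a → b < τ → ∀ ρ > 0, ∀ᶠ ε in 𝓝[>] (0 : ℝ),
      ∀ s ∈ Icc a b, ‖uε ε s - u s‖ ≤ ρ) {ρ h : ℝ} (hρ : 0 < ρ) (hh : 0 < h) :
    ∀ᶠ ε in 𝓝[>] (0 : ℝ), ∃ t, |t - τ| ≤ h ∧ ‖uε ε t - v s₀‖ ≤ ρ := by
  have hr := S.r_pos
  have hc₁ := S.c₁_pos
  have hC₁ := S.C₁_pos
  have hc := S.c_pos
  have hC := S.C_pos
  have hballs : Metric.closedBall ξ (r / 2) ⊆ Metric.closedBall ξ r :=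
    Metric.closedBall_subset_closedBall (by linarith)
  obtain ⟨hQv, hz⟩ := S.orbit_mem_cone hv hlim (fun s hs => hballs (hs₀ s hs)) hne
  set z := ⟪v s₀ - ξ, ℓ⟫ with hzdef
  have hzr : z ≤ r / 2 := by
    have h1 : z ≤ ‖v s₀ - ξ‖ := by
      have := real_inner_le_norm (v s₀ - ξ) ℓ
      rwa [S.norm_eq, mul_one] at this
    have h2 := hs₀ s₀ le_rfl
    rw [Metric.mem_closedBall, dist_eq_norm] at h2
    linarith
  set K := 2 * C₁ / c₁ with hK
  have hKpos : 0 < K := by positivity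
  have hev : ∀ᶠ δ in 𝓝[>] (0 : ℝ), 0 < δ ∧ δ < δ₀ ∧ δ < h ∧ δ < τ - a₀ ∧ K * δ < ρ ∧
      K * δ < r / 2 ∧ C * (K * δ) ^ 2 + 3 / 2 * β * δ < c * z ^ 2 ∧ C * K ^ 2 * δ < β / 8 ∧
      ∀ t ∈ Ico (τ - δ) τ, ‖u t - ξ‖ ≤ z / 4 := by
    have hcont : ∀ (F : ℝ → ℝ), Continuous F → ∀ M, F 0 < M → ∀ᶠ δ in 𝓝[>] (0 : ℝ), F δ < M :=
      fun F hF M hM => nhdsWithin_le_nhds (hF.continuousAt.eventually_lt continuousAt_const hM)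
    have hu' : ∀ᶠ t in 𝓝[<] τ, ‖u t - ξ‖ ≤ z / 4 := by
      have := hu (Metric.closedBall_mem_nhds ξ (show 0 < z / 4 by linarith))
      filter_upwards [this] with t ht using by simpa [dist_eq_norm] using ht
    obtain ⟨a₁, ha₁, ha₁'⟩ := mem_nhdsLT_iff_exists_Ioo_subset.1 hu'
    rw [mem_Iio] at ha₁
    filter_upwards [self_mem_nhdsWithin, hcont id continuous_id δ₀ S.δ₀_pos,
      hcont id continuous_id h hh, hcont id continuous_id (τ - a₀) (sub_pos.2 ha₀),
      hcont (fun δ => K * δ) (by fun_prop) ρ (by simpa),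
      hcont (fun δ => K * δ) (by fun_prop) (r / 2) (by simpa),
      hcont (fun δ => C * (K * δ) ^ 2 + 3 / 2 * β * δ) (by fun_prop) (c * z ^ 2)
        (by simp; positivity),
      hcont (fun δ => C * K ^ 2 * δ) (by fun_prop) (β / 8) (by simp; positivity),
      hcont id continuous_id (τ - a₁) (sub_pos.2 ha₁)] with δ h1 h2 h3 h4 h5 h6 h7 h8 h9
    refine ⟨h1, h2, h3, h4, h5, h6, h7, h8, fun t ht => ha₁' ⟨?_, ht.2⟩⟩
    simp only [id] at h9
    linarith [ht.1]
  obtain ⟨δ, hδ, hδ₀, hδh, hδa, hδρ, hδr, hδz, hδβ, huδ⟩ := hev.exists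
  have hlt := S.lt_sub
  have hgt := S.add_lt
  set ρ' := K * δ with hρ'
  have hρ'pos : 0 < ρ' := by positivity
  have hKδ : 2 * C₁ * δ ≤ c₁ * ρ' := by rw [hρ', hK]; field_simp; rfl
  filter_upwards [self_mem_nhdsWithin, hconv (τ - δ) (τ - δ / 2) (by linarith) (by linarith) (z / 4)
      (by linarith), tendsto_inv_nhdsGT_zero.eventually_gt_atTop
      (4 * r ^ 2 / (c₁ * ρ' ^ 2 * (δ / 2))), tendsto_inv_nhdsGT_zero.eventually_gt_atTop
      (2 * z / (β * δ ^ 2 / 16))] with ε hε hεu hε1 hε2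
  rw [mem_Ioi] at hε
  have hεi : 0 < ε⁻¹ := inv_pos.2 hε
  rw [div_lt_iff₀ (by positivity)] at hε1 hε2
  set U := uε ε with hUdef
  have hU : IsFastSol g T ε U := hsol ε hε
  have hUc : ContinuousOn U (Icc (τ - δ) (τ + δ)) :=
    hU.continuousOn.mono (Icc_subset_Icc (by linarith) (by linarith))
  have hinner : ∀ p : E, |⟪p, ℓ⟫| ≤ ‖p‖ := fun p => by
    simpa [S.norm_eq] using abs_real_inner_le_norm p ℓ
  have hearly : ∀ t ∈ Icc (τ - δ) (τ - δ / 2), ‖U t - ξ‖ ≤ z / 2 := by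
    intro t ht
    have h1 := hεu t ht
    have h2 := huδ t ⟨ht.1, by linarith [ht.2]⟩
    calc ‖U t - ξ‖ = ‖(U t - u t) + (u t - ξ)‖ := by congr 1; abel
      _ ≤ ‖U t - u t‖ + ‖u t - ξ‖ := norm_add_le _ _
      _ ≤ z / 2 := by linarith
  have hcmp : ∀ t₁ ∈ Icc (τ - δ / 2) (τ + δ), (∀ t ∈ Ico (τ - δ) t₁, U t ∈ Metric.closedBall ξ r) →
      ∀ V : ℝ → E, (∀ t, HasDerivAt V (-(ε⁻¹ • g τ (V t))) t) →
      (∀ t ≤ t₁, V t ∈ Metric.closedBall ξ r) → coneForm ℓ κ (U t₁ - V t₁) ≤ ρ' ^ 2 := by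
    intro t₁ ht₁ hUb V hV hVb
    have h1 := S.coneForm_sub_le hε (a := τ - δ) (b := t₁) (U := U) (V := V) (θ := fun t => t) (δ := δ)
      (by linarith [ht₁.1]) (hUc.mono (Icc_subset_Icc_right ht₁.2))
      (fun t _ => (hV t).continuousAt.continuousWithinAt)
      (fun t ht => hU.hasDerivWithinAt_Ici ⟨by linarith [ht.1], by linarith [ht.2, ht₁.2]⟩)
      (fun t _ => (hV t).hasDerivWithinAt) hUb (fun t ht => hVb t ht.2.le)
      (fun t ht => abs_le.2 ⟨by linarith [ht.1], by linarith [ht.2, ht₁.2]⟩) hδ₀.le hρ'pos hKδ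
    rcases h1 with h1 | h1
    · exact h1
    have h2 : ‖U (τ - δ) - V (τ - δ)‖ ≤ 2 * r := by
      have h3 := hearly (τ - δ) ⟨le_rfl, by linarith⟩
      have h4 := hVb (τ - δ) (by linarith [ht₁.1])
      rw [mem_closedBall_iff_norm'] at h4
      calc ‖U (τ - δ) - V (τ - δ)‖ = ‖(U (τ - δ) - ξ) + (ξ - V (τ - δ))‖ := by congr 1; abel
        _ ≤ ‖U (τ - δ) - ξ‖ + ‖ξ - V (τ - δ)‖ := norm_add_le _ _
        _ ≤ 2 * r := by linarith
    have h3 : coneForm ℓ κ (U (τ - δ) - V (τ - δ)) ≤ 4 * r ^ 2 :=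
      (coneForm_le_norm_sq (by linarith [S.one_lt]) _).trans (by nlinarith [norm_nonneg (U (τ - δ) - V (τ - δ))])
    have h4 : ε⁻¹ * (c₁ * ρ' ^ 2) * (δ / 2) ≤ ε⁻¹ * (c₁ * ρ' ^ 2) * (t₁ - (τ - δ)) := by
      gcongr
      linarith [ht₁.1]
    nlinarith [sq_nonneg ρ']
  set m : ℝ → ℝ := fun t => max (‖U t - ξ‖ / r) (|⟪U t - ξ, ℓ⟫| / z) with hm
  have hmc : ContinuousOn m (Icc (τ - δ / 2) (τ + δ)) := by
    have : ContinuousOn U (Icc (τ - δ / 2) (τ + δ)) :=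
      hUc.mono (Icc_subset_Icc_left (by linarith))
    fun_prop
  have hm_early : ∀ t ∈ Icc (τ - δ) (τ - δ / 2), m t < 1 := by
    intro t ht
    have h1 := hearly t ht
    refine max_lt ?_ ?_
    · rw [div_lt_one hr]; linarith
    · rw [div_lt_one hz]; linarith [hinner (U t - ξ)]
  have hm_ball : ∀ t, m t < 1 → U t ∈ Metric.closedBall ξ r := by
    intro t ht
    have := (max_lt_iff.1 ht).1
    rw [div_lt_one hr] at this
    rw [mem_closedBall_iff_norm]
    exact this.le
  have hm_z : ∀ t, m t < 1 → |⟪U t - ξ, ℓ⟫| < z := by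
    intro t ht
    have := (max_lt_iff.1 ht).2
    rwa [div_lt_one hz] at this
  have hball : ∀ t₁, (∀ t ∈ Ico (τ - δ / 2) t₁, m t < 1) →
      ∀ t ∈ Ico (τ - δ) t₁, U t ∈ Metric.closedBall ξ r := by
    intro t₁ hlt t ht
    by_cases htl : t ≤ τ - δ / 2
    · exact hm_ball t (hm_early t ⟨ht.1, htl⟩)
    · exact hm_ball t (hlt t ⟨(not_le.1 htl).le, ht.2⟩)
  have hξ : ∀ t : ℝ, HasDerivAt (fun _ : ℝ => ξ) (-(ε⁻¹ • g τ ξ)) t := fun t => by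
    simpa [S.crit] using hasDerivAt_const t ξ
  have hξm : ξ ∈ Metric.closedBall ξ r := Metric.mem_closedBall_self hr.le
  rcases forall_lt_one_or_exists_first hmc (hm_early _ ⟨by linarith, le_rfl⟩) with hnev | ⟨t₁, ht₁, hm1, hlt1⟩
  · exfalso
    have hgrow := hU.inner_growth (ℓ := ℓ) hεi (by linarith : 0 ≤ τ + δ / 2) (by linarith) (by linarith) ξ
      (m := β * δ / 8) (b := τ + δ) (fun t ht => by
        have hq := hcmp t ⟨by linarith [ht.1], ht.2.le⟩
          (hball t fun s hs => hnev s ⟨hs.1, hs.2.le.trans ht.2.le⟩) _ hξ (fun _ _ => hξm)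
        have habs : |t - τ| = t - τ := abs_of_nonneg (by linarith [ht.1])
        have hd := S.drift t (by rw [habs]; linarith [ht.2]) (U t)
          (hm_ball t (hnev t ⟨by linarith [ht.1], ht.2.le⟩)) ρ' hq
        rw [habs, abs_of_pos hβ] at hd
        have h1 : C * ρ' ^ 2 ≤ β * δ / 8 := by
          calc C * ρ' ^ 2 = C * K ^ 2 * δ * δ := by rw [hρ']; ring
            _ ≤ β / 8 * δ := by gcongr
            _ = β * δ / 8 := by ring
        have h2 : β / 2 * (δ / 2) ≤ β / 2 * (t - τ) :=
          mul_le_mul_of_nonneg_left (by linarith [ht.1]) (by linarith)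
        linarith [mul_nonneg hc.le (sq_nonneg ⟪U t - ξ, ℓ⟫)])
    have h1 := hm_z _ (hnev (τ + δ) ⟨by linarith, le_rfl⟩)
    have h2 := hm_z _ (hnev (τ + δ / 2) ⟨by linarith, by linarith⟩)
    rw [abs_lt] at h1 h2
    rw [show ε⁻¹ * (β * δ / 8) * (τ + δ - (τ + δ / 2)) = ε⁻¹ * (β * δ ^ 2 / 16) by ring] at hgrow
    linarith
  · have hball1 := hball t₁ hlt1
    have hq := hcmp t₁ ⟨ht₁.1.le, ht₁.2⟩ hball1 _ hξ (fun _ _ => hξm)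
    have hzle : |⟪U t₁ - ξ, ℓ⟫| ≤ z := by
      have : |⟪U t₁ - ξ, ℓ⟫| / z ≤ 1 := hm1 ▸ le_max_right _ _
      rwa [div_le_one hz] at this
    have hnorm : ‖U t₁ - ξ‖ < r := by
      have h1 : ⟪U t₁ - ξ, ℓ⟫ ^ 2 ≤ z ^ 2 := by
        rw [← sq_abs]; exact pow_le_pow_left₀ (abs_nonneg _) hzle 2
      have h2 : ‖U t₁ - ξ‖ ^ 2 < r ^ 2 := by
        unfold coneForm at hq
        have h3 : κ * ⟪U t₁ - ξ, ℓ⟫ ^ 2 ≤ 2 * z ^ 2 :=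
          mul_le_mul S.le_two h1 (sq_nonneg _) (by norm_num)
        nlinarith
      exact (pow_lt_pow_iff_left₀ (norm_nonneg _) hr.le two_ne_zero).1 h2
    have hzeq : |⟪U t₁ - ξ, ℓ⟫| = z := by
      refine le_antisymm hzle (not_lt.1 fun hcon => ?_)
      have : m t₁ < 1 := max_lt (by rwa [div_lt_one hr]) (by rwa [div_lt_one hz])
      linarith
    have hUt₁ : U t₁ ∈ Metric.closedBall ξ r := by
      rw [mem_closedBall_iff_norm]; exact hnorm.le
    have htτ : |t₁ - τ| ≤ δ := abs_le.2 ⟨by linarith [ht₁.1], by linarith [ht₁.2]⟩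
    rcases eq_or_eq_neg_of_abs_eq hzeq with hpos | hneg
    · refine ⟨t₁, htτ.trans hδh.le, ?_⟩
      have hq2 := hcmp t₁ ⟨ht₁.1.le, ht₁.2⟩ hball1 (fun t => v (s₀ + ε⁻¹ * (t - t₁)))
        (fun t => by
          have h1 := ((((hasDerivAt_id t).sub_const t₁).const_mul ε⁻¹).const_add s₀)
          have h2 := (hv (s₀ + ε⁻¹ * (t - t₁))).scomp t h1
          exact h2.congr_deriv (by simp))
        (fun t ht => hballs (hs₀ _ (by nlinarith)))
      simp only [sub_self, mul_zero, add_zero] at hq2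
      have h0 : ⟪U t₁ - v s₀, ℓ⟫ = 0 := by
        have : U t₁ - v s₀ = (U t₁ - ξ) - (v s₀ - ξ) := by abel
        rw [this, inner_sub_left, hpos, ← hzdef, sub_self]
      unfold coneForm at hq2
      rw [h0] at hq2
      have : ‖U t₁ - v s₀‖ ^ 2 ≤ ρ' ^ 2 := by linarith
      exact ((pow_le_pow_iff_left₀ (norm_nonneg _) hρ'pos.le two_ne_zero).1 this).trans hδρ.le
    · exfalso
      have hd := S.drift t₁ (htτ.trans hδ₀.le) (U t₁) hUt₁ ρ' hq
      rw [abs_of_pos hβ, hneg, neg_sq] at hd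
      have hpos : 0 < -⟪g t₁ (U t₁), ℓ⟫ := by
        have h1 : -δ ≤ t₁ - τ := by linarith [ht₁.1]
        nlinarith
      have hder := ((hU.hasDerivWithinAt_Iic (s := t₁)
          ⟨by linarith [ht₁.1], by linarith [ht₁.2]⟩).sub_const ξ).inner ℝ
            (hasDerivWithinAt_const t₁ (Iic t₁) ℓ)
      have hle := hasDerivWithinAt_Iic_nonpos ht₁.1 hder (fun s hs => by
        have := (abs_lt.1 (hm_z s (hlt1 s hs))).1
        rw [hneg]
        exact this.le)
      simp only [inner_zero_right, inner_neg_left, real_inner_smul_left, zero_add] at hle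
      nlinarith

end Jump

section FollowOrbit

variable {E : Type*} [NormedAddCommGroup E] [InnerProductSpace ℝ E]

/-- An orbit of a locally Lipschitz field that reaches an equilibrium is constant. -/
lemma eq_of_orbit_apply_eq {G : E → E} (hG : ∀ R, ∃ L, LipschitzOnWith L G (Metric.closedBall 0 R))
    {v : ℝ → E} (hv : ∀ s, HasDerivAt v (-G (v s)) s) {ξ : E} (hξ : G ξ = 0) {s₀ : ℝ}
    (h : v s₀ = ξ) (s : ℝ) : v s = ξ := by
  have hvc : Continuous v := continuous_iff_continuousAt.2 fun s => (hv s).continuousAt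
  obtain ⟨R, hR⟩ := (isCompact_Icc (a := min s s₀ - 1) (b := max s s₀ + 1)).image hvc
    |>.isBounded.subset_closedBall 0
  obtain ⟨L, hL⟩ := hG R
  have hsub : ∀ t ∈ Ioo (min s s₀ - 1) (max s s₀ + 1), v t ∈ Metric.closedBall 0 R :=
    fun t ht => hR ⟨t, Ioo_subset_Icc_self ht, rfl⟩
  have hs₀ : s₀ ∈ Ioo (min s s₀ - 1) (max s s₀ + 1) :=
    ⟨by linarith [min_le_right s s₀], by linarith [le_max_right s s₀]⟩
  have hs : s ∈ Ioo (min s s₀ - 1) (max s s₀ + 1) :=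
    ⟨by linarith [min_le_left s s₀], by linarith [le_max_left s s₀]⟩
  exact ODE_solution_unique_of_mem_Ioo (v := fun _ x => -G x)
    (s := fun _ => Metric.closedBall 0 R) (K := L) (g := fun _ => ξ)
    (fun _ _ => LipschitzOnWith.of_dist_le_mul fun x hx y hy => by
      simpa only [dist_neg_neg] using hL.dist_le_mul x hx y hy) hs₀
    (fun t ht => ⟨hv t, hsub t ht⟩)
    (fun t ht => ⟨by simpa [hξ] using hasDerivAt_const t ξ, h ▸ hsub s₀ hs₀⟩) h hs

variable {g : ℝ → E → E} {T τ : ℝ}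

/-- Fast solutions that come close to a point of an orbit of the frozen system at time `τ`, at
times close to `τ`, come close to all later points of that orbit. -/
lemma eventually_exists_near_orbit_of_le {R : ℝ} {L : NNReal}
    (hL : LipschitzOnWith L (g τ) (Metric.closedBall 0 R))
    (hτ : τ ∈ Ioo 0 T)
    (hη : ∀ η > 0, ∃ δ > 0, ∀ t ∈ Icc 0 T, |t - τ| ≤ δ → ∀ x ∈ Metric.closedBall (0 : E) R,
      ‖g t x - g τ x‖ ≤ η)
    {v : ℝ → E} (hv : ∀ s, HasDerivAt v (-g τ (v s)) s) {s₀ s₁ : ℝ} (hs : s₀ ≤ s₁)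
    (hvR : ∀ s ∈ Icc s₀ s₁, v s ∈ Metric.closedBall 0 R)
    {uε : ℝ → ℝ → E} (hsol : ∀ ε > 0, IsFastSol g T ε (uε ε))
    (hbd : ∀ᶠ ε in 𝓝[>] (0 : ℝ), ∀ t ∈ Icc 0 T, uε ε t ∈ Metric.closedBall 0 R)
    (hnear : ∀ ρ > 0, ∀ h > 0, ∀ᶠ ε in 𝓝[>] (0 : ℝ), ∃ t, |t - τ| ≤ h ∧ ‖uε ε t - v s₀‖ ≤ ρ)
    {ρ h : ℝ} (hρ : 0 < ρ) (hh : 0 < h) :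
    ∀ᶠ ε in 𝓝[>] (0 : ℝ), ∃ t, |t - τ| ≤ h ∧ ‖uε ε t - v s₁‖ ≤ ρ := by
  set L' : NNReal := L + 1 with hL'
  have hL'1 : (1 : ℝ) ≤ L' := by simp [hL']
  have hLip : LipschitzOnWith L' (g τ) (Metric.closedBall 0 R) := hL.weaken (by simp [hL'])
  set S := s₁ - s₀ with hS
  have hS0 : 0 ≤ S := sub_nonneg.2 hs
  set ρ' := ρ / (2 * Real.exp (L' * S)) with hρ'
  have hρ'pos : 0 < ρ' := by positivity
  obtain ⟨δ, hδ, hgδ⟩ := hη ρ' hρ'pos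
  set h' := min (h / 2) (min (δ / 2) (min (τ / 2) ((T - τ) / 2))) with hh'
  have hh'pos : 0 < h' := by
    have := hτ.1; have := hτ.2
    refine lt_min (by linarith) (lt_min (by linarith) (lt_min (by linarith) (by linarith)))
  have e1 : h' ≤ h / 2 := min_le_left _ _
  have e2 : h' ≤ δ / 2 := (min_le_right _ _).trans (min_le_left _ _)
  have e3 : h' ≤ τ / 2 := (min_le_right _ _).trans ((min_le_right _ _).trans (min_le_left _ _))
  have e4 : h' ≤ (T - τ) / 2 :=
    (min_le_right _ _).trans ((min_le_right _ _).trans (min_le_right _ _))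
  have hεS : ∀ᶠ ε in 𝓝[>] (0 : ℝ), ε * S < h' :=
    nhdsWithin_le_nhds ((by fun_prop : Continuous fun ε : ℝ => ε * S).continuousAt.eventually_lt
      continuousAt_const (by simpa))
  filter_upwards [self_mem_nhdsWithin, hbd, hnear ρ' hρ'pos h' hh'pos, hεS]
    with ε hε hbd ⟨a, ha, hUa⟩ hεS
  rw [mem_Ioi] at hε
  have hε0 := hε.ne'
  have hεi : 0 < ε⁻¹ := inv_pos.2 hε
  rw [abs_le] at ha
  have hU := hsol ε hε
  have hb0 : 0 ≤ ε * S := mul_nonneg hε.le hS0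
  have hab : ∀ t ∈ Icc a (a + ε * S), t ∈ Ico 0 T ∧ |t - τ| ≤ δ := fun t ht =>
    ⟨⟨by linarith [ht.1], by linarith [ht.2]⟩,
      abs_le.2 ⟨by linarith [ht.1], by linarith [ht.2]⟩⟩
  have hV : ∀ t, HasDerivAt (fun t => v (s₀ + ε⁻¹ * (t - a)))
      (-(ε⁻¹ • g τ (v (s₀ + ε⁻¹ * (t - a))))) t := fun t => by
    have h1 := ((((hasDerivAt_id t).sub_const a).const_mul ε⁻¹).const_add s₀)
    have h2 := (hv (s₀ + ε⁻¹ * (t - a))).scomp t h1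
    exact h2.congr_deriv (by simp)
  have hVR : ∀ t ∈ Icc a (a + ε * S), v (s₀ + ε⁻¹ * (t - a)) ∈ Metric.closedBall 0 R := by
    intro t ht
    apply hvR
    have h1 : ε⁻¹ * (t - a) ≤ S := by
      rw [inv_mul_le_iff₀ hε]; linarith [ht.2]
    exact ⟨by nlinarith [ht.1], by linarith⟩
  have key := dist_le_of_approx_trajectories_ODE_of_mem (v := fun _ x => -(ε⁻¹ • g τ x))
    (s := fun _ => Metric.closedBall 0 R) (K := ε⁻¹.toNNReal * L') (a := a) (b := a + ε * S)
    (f := uε ε) (f' := fun t => -(ε⁻¹ • g t (uε ε t)))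
    (g := fun t => v (s₀ + ε⁻¹ * (t - a))) (g' := fun t => -(ε⁻¹ • g τ (v (s₀ + ε⁻¹ * (t - a)))))
    (εf := ε⁻¹ * ρ') (εg := 0) (δ := ρ')
    (fun t _ => by
      refine LipschitzOnWith.of_dist_le_mul fun x hx y hy => ?_
      rw [dist_neg_neg, dist_smul₀, NNReal.coe_mul, Real.coe_toNNReal _ hεi.le, mul_assoc, Real.norm_eq_abs, abs_of_pos hεi]
      exact mul_le_mul_of_nonneg_left (hLip.dist_le_mul x hx y hy) hεi.le)
    (hU.continuousOn.mono fun t ht => Ico_subset_Icc_self (hab t ht).1)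
    (fun t ht => hU.hasDerivWithinAt_Ici (hab t (Ico_subset_Icc_self ht)).1)
    (fun t ht => by
      have h1 := hab t (Ico_subset_Icc_self ht)
      rw [dist_neg_neg, dist_smul₀, Real.norm_eq_abs, abs_of_pos hεi, dist_eq_norm]
      exact mul_le_mul_of_nonneg_left (hgδ t (Ico_subset_Icc_self h1.1) h1.2 _
        (hbd t (Ico_subset_Icc_self h1.1))) hεi.le)
    (fun t ht => hbd t (Ico_subset_Icc_self (hab t (Ico_subset_Icc_self ht)).1))
    (fun t _ => (hV t).continuousAt.continuousWithinAt)
    (fun t _ => (hV t).hasDerivWithinAt) (fun t _ => by simp)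
    (fun t ht => hVR t (Ico_subset_Icc_self ht))
    (by simpa [dist_eq_norm] using hUa) (a + ε * S) ⟨by linarith, le_rfl⟩
  refine ⟨a + ε * S, abs_le.2 ⟨by linarith, by linarith⟩, ?_⟩
  have hK : ((ε⁻¹.toNNReal * L' : NNReal) : ℝ) = ε⁻¹ * L' := by
    rw [NNReal.coe_mul, Real.coe_toNNReal _ hεi.le]
  have hL0 : (L' : ℝ) ≠ 0 := by linarith
  rw [hK, gronwallBound_of_K_ne_0 (by positivity)] at key
  simp only [add_sub_cancel_left, add_zero] at key
  rw [show ε⁻¹ * (L' : ℝ) * (ε * S) = L' * S by field_simp,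
    show ε⁻¹ * ρ' / (ε⁻¹ * L') = ρ' / L' by field_simp,
    show s₀ + ε⁻¹ * (ε * S) = s₁ by field_simp; rw [hS]; ring, dist_eq_norm] at key
  have h1 : ρ' / L' ≤ ρ' := div_le_self hρ'pos.le hL'1
  have h2 : 1 ≤ Real.exp (L' * S) := Real.one_le_exp (by positivity)
  have h3 : ρ' * Real.exp (L' * S) = ρ / 2 := by rw [hρ']; field_simp
  have h4 : ρ' / L' * (Real.exp (L' * S) - 1) ≤ ρ' * (Real.exp (L' * S) - 1) :=
    mul_le_mul_of_nonneg_right h1 (by linarith)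
  linarith

end FollowOrbit

section LinearAlgebra

variable {E : Type*} [NormedAddCommGroup E] [InnerProductSpace ℝ E]

lemma exists_pos_mul_norm_sq_le_of_posDef [ProperSpace E] {A : E →L[ℝ] E}
    (hA : ∀ p, p ≠ 0 → 0 < ⟪A p, p⟫) : ∃ lam > 0, ∀ p, lam * ‖p‖ ^ 2 ≤ ⟪A p, p⟫ := by
  rcases (Metric.sphere (0 : E) 1).eq_empty_or_nonempty with h | h
  · refine ⟨1, one_pos, fun p => ?_⟩
    have hp : p = 0 := by
      by_contra hp
      have : (‖p‖⁻¹ • p) ∈ Metric.sphere (0 : E) 1 := by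
        simp [norm_smul, norm_ne_zero_iff.2 hp]
      simp [h] at this
    simp [hp]
  · obtain ⟨q, hq, hmin⟩ := (isCompact_sphere (0 : E) 1).exists_isMinOn h
      (show ContinuousOn (fun p => ⟪A p, p⟫) _ by fun_prop)
    have hq0 : q ≠ 0 := by rintro rfl; simp at hq
    refine ⟨_, hA q hq0, fun p => ?_⟩
    by_cases hp : p = 0
    · simp [hp]
    have hpn : 0 < ‖p‖ := norm_pos_iff.2 hp
    have := hmin (show (‖p‖⁻¹ • p) ∈ Metric.sphere (0 : E) 1 by
      simp [norm_smul, norm_ne_zero_iff.2 hp])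
    simp only [mem_ofPred_eq, map_smul, real_inner_smul_left, real_inner_smul_right] at this
    calc ⟪A q, q⟫ * ‖p‖ ^ 2 ≤ ‖p‖⁻¹ * (‖p‖⁻¹ * ⟪A p, p⟫) * ‖p‖ ^ 2 := by gcongr
      _ = ⟪A p, p⟫ := by field_simp

lemma apply_eq_zero_of_posSemidef {A : E →L[ℝ] E} (hsymm : ∀ p q, ⟪A p, q⟫ = ⟪p, A q⟫)
    (hA : ∀ p, 0 ≤ ⟪A p, p⟫) {p : E} (hp : ⟪A p, p⟫ = 0) : A p = 0 := by
  set b := ⟪A (A p), A p⟫ with hb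
  have hb0 : 0 ≤ b := hA _
  set a := ⟪A p, A p⟫ with ha
  have ha0 : 0 ≤ a := real_inner_self_nonneg
  have key : ∀ s : ℝ, 0 ≤ 2 * s * a + s ^ 2 * b := by
    intro s
    have := hA (p + s • A p)
    rw [map_add, map_smul, inner_add_left, inner_add_right, inner_add_right, real_inner_smul_right,
      real_inner_smul_left, real_inner_smul_left, real_inner_smul_right, hp, hsymm (A p) p,
      ← ha, ← hb] at this
    linarith
  have h1 := key (-(a / (b + 1)))
  have h2 : 2 * -(a / (b + 1)) * a + (-(a / (b + 1))) ^ 2 * b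
      = -(a ^ 2 * (b + 2) / (b + 1) ^ 2) := by field_simp; ring
  rw [h2] at h1
  have h3 : a ^ 2 * (b + 2) / (b + 1) ^ 2 = 0 := le_antisymm (by linarith) (by positivity)
  have h4 : a = 0 := by
    rcases div_eq_zero_iff.1 h3 with h | h
    · rcases mul_eq_zero.1 h with h | h
      · exact pow_eq_zero_iff two_ne_zero |>.1 h
      · linarith
    · have := pow_eq_zero_iff two_ne_zero |>.1 h
      linarith
  exact inner_self_eq_zero.1 h4

/-- A positive semidefinite operator is coercive transversally to a one-dimensional kernel. -/
lemma exists_pos_mul_le_of_ker_eq_span [ProperSpace E] {A : E →L[ℝ] E}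
    (hsymm : ∀ p q, ⟪A p, q⟫ = ⟪p, A q⟫) (hA : ∀ p, 0 ≤ ⟪A p, p⟫) {ℓ : E} (hℓ : ‖ℓ‖ = 1)
    (hker : LinearMap.ker (A : E →ₗ[ℝ] E) = Submodule.span ℝ {ℓ}) :
    ∃ lam > 0, ∀ p, lam * (‖p‖ ^ 2 - ⟪p, ℓ⟫ ^ 2) ≤ ⟪A p, p⟫ := by
  have hℓℓ : ⟪ℓ, ℓ⟫ = 1 := by rw [real_inner_self_eq_norm_sq, hℓ, one_pow]
  have hAℓ : A ℓ = 0 := by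
    have : ℓ ∈ LinearMap.ker (A : E →ₗ[ℝ] E) := hker ▸ Submodule.mem_span_singleton_self ℓ
    simpa using this
  obtain ⟨lam, hlam, h⟩ := exists_pos_mul_norm_sq_le_of_posDef
    (A := A + (innerSL ℝ ℓ).smulRight ℓ) (fun p hp => by
      simp only [_root_.add_apply, ContinuousLinearMap.smulRight_apply,
        innerSL_apply_apply, inner_add_left, real_inner_smul_left]
      rcases (hA p).lt_or_eq with h | h
      · nlinarith [mul_self_nonneg ⟪ℓ, p⟫]
      · have hp' : p ∈ LinearMap.ker (A : E →ₗ[ℝ] E) := by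
          simpa using apply_eq_zero_of_posSemidef hsymm hA h.symm
        rw [hker] at hp'
        obtain ⟨c, rfl⟩ := Submodule.mem_span_singleton.1 hp'
        have hc : c ≠ 0 := by rintro rfl; simp at hp
        rw [← h, real_inner_smul_right, hℓℓ]
        simpa using mul_self_pos.2 hc)
  refine ⟨lam, hlam, fun p => ?_⟩
  have := h (p - ⟪p, ℓ⟫ • ℓ)
  have h1 : ⟪p - ⟪p, ℓ⟫ • ℓ, ℓ⟫ = 0 := by
    rw [inner_sub_left, real_inner_smul_left, hℓℓ]; ring
  have h2 : ⟪A p, ℓ⟫ = 0 := by rw [hsymm, hAℓ, inner_zero_right]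
  have h3 : ‖p - ⟪p, ℓ⟫ • ℓ‖ ^ 2 = ‖p‖ ^ 2 - ⟪p, ℓ⟫ ^ 2 := by
    rw [norm_sub_sq_real, norm_smul, real_inner_smul_right, hℓ, mul_one, Real.norm_eq_abs, sq_abs]
    ring
  rw [h3] at this
  simpa [real_inner_comm _ ℓ, h1, hAℓ, inner_sub_right, real_inner_smul_right, h2] using this

end LinearAlgebra

section Regularity

variable {E G : Type*} [NormedAddCommGroup E] [NormedSpace ℝ E]
  [NormedAddCommGroup G] [NormedSpace ℝ G] {T : ℝ} {F : ℝ → E → G} {m : WithTop ℕ∞}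

lemma uniqueDiffOn_Icc_prod_univ (hT : 0 < T) :
    UniqueDiffOn ℝ (Icc 0 T ×ˢ (univ : Set E)) :=
  (uniqueDiffOn_Icc hT).prod uniqueDiffOn_univ

lemma hasFDerivAt_of_contDiffOn_uncurry
    (hF : ContDiffOn ℝ m (Function.uncurry F) (Icc 0 T ×ˢ univ)) (hm : m ≠ 0) {t : ℝ}
    (ht : t ∈ Icc 0 T) (x : E) :
    HasFDerivAt (F t) ((fderivWithin ℝ (Function.uncurry F) (Icc 0 T ×ˢ univ) (t, x)).comp
      (ContinuousLinearMap.inr ℝ ℝ E)) x := by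
  have h1 := ((hF (t, x) ⟨ht, mem_univ _⟩).differentiableWithinAt hm).hasFDerivWithinAt
  have h2 : HasFDerivWithinAt (fun y : E => (t, y)) (ContinuousLinearMap.inr ℝ ℝ E) univ x :=
    (hasFDerivAt_prodMk_right t x).hasFDerivWithinAt
  simpa [Function.comp_def, Function.uncurry] using
    h1.comp x h2 (fun y _ => ⟨ht, mem_univ _⟩)

lemma contDiff_of_contDiffOn_uncurry
    (hF : ContDiffOn ℝ m (Function.uncurry F) (Icc 0 T ×ˢ univ)) {t : ℝ}
    (ht : t ∈ Icc 0 T) : ContDiff ℝ m (F t) := by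
  have : ContDiff ℝ m (fun y : E => (t, y)) := by fun_prop
  exact contDiffOn_univ.1 (hF.comp this.contDiffOn fun y _ => ⟨ht, mem_univ _⟩)

lemma contDiffAt_of_contDiffOn_uncurry
    (hF : ContDiffOn ℝ m (Function.uncurry F) (Icc 0 T ×ˢ univ)) {t : ℝ}
    (ht : t ∈ Ioo 0 T) (x : E) : ContDiffAt ℝ m (Function.uncurry F) (t, x) :=
  hF.contDiffAt (prod_mem_nhds (Icc_mem_nhds ht.1 ht.2) univ_mem)

lemma ContDiffOn.fderiv_uncurry (hT : 0 < T) {m' : WithTop ℕ∞} (hm : m' + 1 ≤ m)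
    (hF : ContDiffOn ℝ m (Function.uncurry F) (Icc 0 T ×ˢ univ)) :
    ContDiffOn ℝ m' (Function.uncurry fun t x => fderiv ℝ (F t) x) (Icc 0 T ×ˢ univ) := by
  have h1 := hF.fderivWithin (uniqueDiffOn_Icc_prod_univ hT) hm
  have h2 := h1.clm_comp (contDiffOn_const (c := ContinuousLinearMap.inr ℝ ℝ E))
  refine h2.congr fun p hp => ?_
  have hm0 : m ≠ 0 := by rintro rfl; simp at hm
  exact (hasFDerivAt_of_contDiffOn_uncurry hF hm0 hp.1 p.2).fderiv

/-- Near any point, all `F t` are approximated by the derivative at that point. -/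
lemma exists_norm_sub_sub_le (hT : 0 < T) (hm : 1 ≤ m)
    (hF : ContDiffOn ℝ m (Function.uncurry F) (Icc 0 T ×ˢ univ)) {τ : ℝ} (hτ : τ ∈ Icc 0 T)
    (ξ : E) {η : ℝ} (hη : 0 < η) :
    ∃ r > 0, ∀ t ∈ Icc 0 T, |t - τ| ≤ r → ∀ x ∈ Metric.closedBall ξ r,
      ∀ y ∈ Metric.closedBall ξ r,
        ‖F t x - F t y - fderiv ℝ (F τ) ξ (x - y)‖ ≤ η * ‖x - y‖ := by
  have h1 := (hF.fderiv_uncurry (m' := 0) hT (by simpa using hm)).continuousOn (τ, ξ)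
    ⟨hτ, mem_univ _⟩
  obtain ⟨r, hr, h⟩ := Metric.continuousWithinAt_iff.1 h1 η hη
  refine ⟨r / 2, by linarith, fun t ht htr x hx y hy => ?_⟩
  have hm0 : m ≠ 0 := by rintro rfl; simp at hm
  refine (convex_closedBall ξ (r / 2)).norm_image_sub_le_of_norm_hasFDerivWithin_le'
    (f := F t) (f' := fun z => fderiv ℝ (F t) z) (fun z _ =>
      (hasFDerivAt_of_contDiffOn_uncurry hF hm0 ht z).differentiableAt.hasFDerivAt.hasFDerivWithinAt)
    (fun z hz => ?_) hy hx
  have := h (x := (t, z)) ⟨ht, mem_univ _⟩ (by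
    rw [Prod.dist_eq]
    exact max_lt (by rw [Real.dist_eq]; linarith) ((Metric.mem_closedBall.1 hz).trans_lt (by linarith)))
  rw [dist_eq_norm] at this
  exact this.le

end Regularity

section Gradient

variable {E : Type*} [NormedAddCommGroup E] [InnerProductSpace ℝ E] [CompleteSpace E]
  {T : ℝ} {f : ℝ → E → ℝ}

lemma contDiffOn_uncurry_gradient (hT : 0 < T)
    (hf : ContDiffOn ℝ 3 (Function.uncurry f) (Icc 0 T ×ˢ univ)) :
    ContDiffOn ℝ 2 (Function.uncurry fun t x => gradient (f t) x) (Icc 0 T ×ˢ univ) :=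
  (InnerProductSpace.toDual ℝ E).symm.contDiff.comp_contDiffOn
    (hf.fderiv_uncurry (m' := 2) hT (by norm_num))

end Gradient

section Stability

variable {E : Type*} [NormedAddCommGroup E] [InnerProductSpace ℝ E] [ProperSpace E]
  {g : ℝ → E → E} {T τ : ℝ}

/-- Near a point with positive definite derivative the fields `g t` are strongly monotone. -/
lemma exists_strongly_monotone (hT : 0 < T)
    (hg : ContDiffOn ℝ 2 (Function.uncurry g) (Icc 0 T ×ˢ univ)) (hτ : τ ∈ Icc 0 T) {ξ : E}
    (hpd : ∀ p, p ≠ 0 → 0 < ⟪fderiv ℝ (g τ) ξ p, p⟫) :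
    ∃ α > 0, ∃ r > 0, ∀ t ∈ Icc 0 T, |t - τ| ≤ r → ∀ x ∈ Metric.closedBall ξ r,
      ∀ y ∈ Metric.closedBall ξ r, α * ‖x - y‖ ^ 2 ≤ ⟪g t x - g t y, x - y⟫ := by
  obtain ⟨lam, hlam, hA⟩ := exists_pos_mul_norm_sq_le_of_posDef hpd
  obtain ⟨r, hr, h⟩ := exists_norm_sub_sub_le hT one_le_two hg hτ ξ (half_pos hlam)
  refine ⟨lam / 2, half_pos hlam, r, hr, fun t ht htr x hx y hy => ?_⟩
  have h1 := h t ht htr x hx y hy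
  have h2 := (abs_le.1 ((abs_real_inner_le_norm
    (g t x - g t y - fderiv ℝ (g τ) ξ (x - y)) (x - y)).trans
    (mul_le_mul_of_nonneg_right h1 (norm_nonneg _)))).1
  rw [inner_sub_left] at h2
  nlinarith [hA (x - y)]

/-- Near a stable equilibrium at time `τ`, fast solutions stay close to it for times close
to `τ`. -/
lemma exists_trap_of_posDef (hT : 0 < T)
    (hg : ContDiffOn ℝ 2 (Function.uncurry g) (Icc 0 T ×ˢ univ)) (hτ : τ ∈ Icc 0 T) {ξ : E}
    (hξ : g τ ξ = 0) (hpd : ∀ p, p ≠ 0 → 0 < ⟪fderiv ℝ (g τ) ξ p, p⟫) {ρ₀ : ℝ} (hρ₀ : 0 < ρ₀) :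
    ∃ ρ > 0, ρ ≤ ρ₀ ∧ ∃ h > 0, ∀ ε > 0, ∀ U, IsFastSol g T ε U → ∀ a b, 0 ≤ a → b ≤ T →
      τ - h ≤ a → b ≤ τ + h → ‖U a - ξ‖ ≤ ρ → ∀ s ∈ Icc a b, ‖U s - ξ‖ ≤ ρ := by
  obtain ⟨α, hα, r, hr, hmono⟩ := exists_strongly_monotone hT hg hτ hpd
  set ρ := min ρ₀ r with hρ
  have hρpos : 0 < ρ := lt_min hρ₀ hr
  have hcont : ContinuousOn (fun t => g t ξ) (Icc 0 T) :=
    hg.continuousOn.comp (f := fun t => (t, ξ)) (by fun_prop) fun t ht => ⟨ht, mem_univ _⟩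
  obtain ⟨δ, hδ, hδg⟩ := Metric.continuousWithinAt_iff.1 (hcont τ hτ) (α * ρ / 2) (by positivity)
  refine ⟨ρ, hρpos, min_le_left _ _, min r (δ / 2), lt_min hr (half_pos hδ),
    fun ε hε U hU a b ha hb hah hbh hUa => ?_⟩
  refine hU.norm_sub_le hε ha hb (c := fun _ => ξ) (c' := fun _ => 0) (M := 0)
    (m := α * ρ ^ 2 / 2) continuousOn_const (fun s _ => hasDerivWithinAt_const _ _ _) (by simp)
    hρpos (fun s hs x hx => ?_) (by simp; positivity) hUa
  have hsT : s ∈ Icc 0 T := ⟨ha.trans hs.1, hs.2.le.trans hb⟩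
  have hsr : |s - τ| ≤ min r (δ / 2) := abs_le.2 ⟨by linarith [hs.1], by linarith [hs.2]⟩
  have h1 := hmono s hsT (hsr.trans (min_le_left _ _)) x
    (by rw [mem_closedBall_iff_norm, hx]; exact min_le_right _ _) ξ
    (Metric.mem_closedBall_self hr.le)
  have h2 := hδg hsT (by
    rw [Real.dist_eq]; exact (hsr.trans (min_le_right _ _)).trans_lt (half_lt_self hδ))
  rw [dist_eq_norm, hξ, sub_zero] at h2
  have h3 := (abs_le.1 ((abs_real_inner_le_norm (g s ξ) (x - ξ)).trans
    (mul_le_mul_of_nonneg_right h2.le (norm_nonneg _)))).1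
  rw [inner_sub_left, hx] at h1
  rw [hx] at h3
  nlinarith

lemma exists_uniformly_monotone (hT : 0 < T)
    (hg : ContDiffOn ℝ 2 (Function.uncurry g) (Icc 0 T ×ˢ univ)) {a b : ℝ} (ha : 0 ≤ a)
    (hb : b ≤ T) {u : ℝ → E} (hu : ContinuousOn u (Icc a b))
    (hcrit : ∀ s ∈ Icc a b, g s (u s) = 0)
    (hpd : ∀ s ∈ Icc a b, ∀ p, p ≠ 0 → 0 < ⟪fderiv ℝ (g s) (u s) p, p⟫) :
    ∃ α > 0, ∃ r > 0, ∀ s ∈ Icc a b, ∀ x, ‖x - u s‖ ≤ r →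
      α * ‖x - u s‖ ^ 2 ≤ ⟪g s x, x - u s⟫ := by
  refine (isCompact_Icc (a := a) (b := b)).induction_on
    (p := fun S => ∃ α > 0, ∃ r > 0, ∀ s ∈ S, ∀ x, ‖x - u s‖ ≤ r →
      α * ‖x - u s‖ ^ 2 ≤ ⟪g s x, x - u s⟫) ⟨1, one_pos, 1, one_pos, by simp⟩ ?_ ?_ ?_
  · rintro S S' hS ⟨α, hα, r, hr, h⟩
    exact ⟨α, hα, r, hr, fun s hs => h s (hS hs)⟩
  · rintro S S' ⟨α, hα, r, hr, h⟩ ⟨α', hα', r', hr', h'⟩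
    refine ⟨min α α', lt_min hα hα', min r r', lt_min hr hr', ?_⟩
    rintro s (hs | hs) x hx
    · refine le_trans ?_ (h s hs x (hx.trans (min_le_left _ _)))
      gcongr
      exact min_le_left _ _
    · refine le_trans ?_ (h' s hs x (hx.trans (min_le_right _ _)))
      gcongr
      exact min_le_right _ _
  · intro τ hτ
    obtain ⟨α, hα, r, hr, h⟩ := exists_strongly_monotone hT hg ⟨ha.trans hτ.1, hτ.2.trans hb⟩
      (hpd τ hτ)
    have hball : ∀ᶠ s in 𝓝[Icc a b] τ, u s ∈ Metric.closedBall (u τ) (r / 2) :=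
      hu τ hτ (Metric.closedBall_mem_nhds _ (half_pos hr))
    have hclose : ∀ᶠ s in 𝓝[Icc a b] τ, s ∈ Metric.closedBall τ r :=
      nhdsWithin_le_nhds (Metric.closedBall_mem_nhds _ hr)
    refine ⟨_, hball.and (hclose.and self_mem_nhdsWithin), α, hα, r / 2, half_pos hr, ?_⟩
    rintro s ⟨hus, hsr, hs⟩ x hx
    rw [Metric.mem_closedBall, Real.dist_eq] at hsr
    have := h s ⟨ha.trans hs.1, hs.2.trans hb⟩ hsr x (by
      rw [Metric.mem_closedBall] at hus ⊢
      rw [← dist_eq_norm] at hx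
      linarith [dist_triangle x (u s) (u τ)]) (u s)
      (Metric.closedBall_subset_closedBall (by linarith) hus)
    rwa [hcrit s hs, sub_zero] at this

/-- Fast solutions starting close to a branch of stable equilibria follow it. -/
lemma exists_follow_branch (hT : 0 < T)
    (hg : ContDiffOn ℝ 2 (Function.uncurry g) (Icc 0 T ×ˢ univ)) {a b : ℝ} (ha : 0 ≤ a)
    (hb : b ≤ T) {u u' : ℝ → E} (hu : ContinuousOn u (Icc a b))
    (hu' : ∀ s ∈ Ico a b, HasDerivWithinAt u (u' s) (Ici s) s) {M : ℝ}
    (hM : ∀ s ∈ Ico a b, ‖u' s‖ ≤ M) (hcrit : ∀ s ∈ Icc a b, g s (u s) = 0)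
    (hpd : ∀ s ∈ Icc a b, ∀ p, p ≠ 0 → 0 < ⟪fderiv ℝ (g s) (u s) p, p⟫) {ρ₀ : ℝ} (hρ₀ : 0 < ρ₀) :
    ∃ ρ > 0, ρ ≤ ρ₀ ∧ ∀ᶠ ε in 𝓝[>] (0 : ℝ), ∀ U, IsFastSol g T ε U → ∀ a' ∈ Icc a b,
      ‖U a' - u a'‖ ≤ ρ → ∀ s ∈ Icc a' b, ‖U s - u s‖ ≤ ρ := by
  obtain ⟨α, hα, r, hr, h⟩ := exists_uniformly_monotone hT hg ha hb hu hcrit hpd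
  set ρ := min ρ₀ r with hρ
  have hρpos : 0 < ρ := lt_min hρ₀ hr
  have hsmall : ∀ᶠ ε in 𝓝[>] (0 : ℝ), ε * M * ρ < α * ρ ^ 2 :=
    nhdsWithin_le_nhds ((by fun_prop : Continuous fun ε : ℝ => ε * M * ρ).continuousAt.eventually_lt
      continuousAt_const (by simp; positivity))
  refine ⟨ρ, hρpos, min_le_left _ _, ?_⟩
  filter_upwards [self_mem_nhdsWithin, hsmall] with ε hε hεM U hU a' ha' hUa
  have hsub : Ico a' b ⊆ Ico a b := Ico_subset_Ico_left ha'.1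
  refine hU.norm_sub_le hε (ha.trans ha'.1) hb (hu.mono (Icc_subset_Icc_left ha'.1))
    (fun s hs => hu' s (hsub hs)) (fun s hs => hM s (hsub hs)) hρpos (fun s hs x hx => ?_) hεM hUa
  have := h s (Ico_subset_Icc_self (hsub hs)) x (by rw [hx]; exact min_le_right _ _)
  rwa [hx] at this

end Stability

section SaddleNodeConstruction

variable {E : Type*} [NormedAddCommGroup E]

/-- Second order expansion at a critical point. -/
lemma exists_abs_sub_le_of_fderiv_eq_zero [NormedSpace ℝ E] {Φ : E → ℝ} (hΦ : ContDiff ℝ 2 Φ)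
    {ξ : E} (h0 : fderiv ℝ Φ ξ = 0) {η : ℝ} (hη : 0 < η) :
    ∃ r > 0, ∀ p : E, ‖p‖ ≤ r →
      |Φ (ξ + p) - Φ ξ - 2⁻¹ * fderiv ℝ (fderiv ℝ Φ) ξ p p| ≤ η * ‖p‖ ^ 2 := by
  have hd : Differentiable ℝ Φ := hΦ.differentiable two_ne_zero
  have hd2 : HasFDerivAt (fderiv ℝ Φ) (fderiv ℝ (fderiv ℝ Φ) ξ) ξ :=
    ((hΦ.fderiv_right (m := 1) (by norm_num)).differentiable one_ne_zero ξ).hasFDerivAt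
  have h1 := hd2.isLittleO.def hη
  obtain ⟨r, hr, hball⟩ := Metric.nhds_basis_closedBall.eventually_iff.1 h1
  refine ⟨r, hr, fun p hp => ?_⟩
  set B := fderiv ℝ (fderiv ℝ Φ) ξ with hB
  have key := norm_image_sub_le_of_norm_deriv_le_segment_01'
    (f := fun θ : ℝ => Φ (ξ + θ • p) - 2⁻¹ * θ ^ 2 * B p p)
    (f' := fun θ => fderiv ℝ Φ (ξ + θ • p) p - θ * B p p) (C := η * ‖p‖ ^ 2)
    (fun θ _ => by
      have h2 : HasDerivAt (fun θ : ℝ => ξ + θ • p) p θ := by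
        simpa using ((hasDerivAt_id θ).smul_const p).const_add ξ
      have h3 := (hd (ξ + θ • p)).hasFDerivAt.comp_hasDerivAt θ h2
      have h4 := (((hasDerivAt_id θ).pow 2).const_mul 2⁻¹).mul_const (B p p)
      have h5 := (h3.sub h4).hasDerivWithinAt (s := Icc 0 1)
      refine h5.congr_deriv ?_
      simp) (fun θ hθ => by
      have h2 := hball (x := ξ + θ • p) (by
        rw [mem_closedBall_iff_norm, add_sub_cancel_left, norm_smul, Real.norm_eq_abs,
          abs_of_nonneg hθ.1]
        nlinarith [hθ.2, norm_nonneg p])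
      rw [h0, sub_zero, add_sub_cancel_left, norm_smul, Real.norm_eq_abs,
        abs_of_nonneg hθ.1, map_smul] at h2
      have h3 := (fderiv ℝ Φ (ξ + θ • p) - θ • B p).le_of_opNorm_le h2 p
      simp only [_root_.sub_apply, _root_.smul_apply, smul_eq_mul] at h3
      refine h3.trans ?_
      have := mul_nonneg hη.le (sq_nonneg ‖p‖)
      nlinarith [hθ.2])
  simp only [one_smul, zero_smul, add_zero, Real.norm_eq_abs] at key
  convert key using 2
  ring

variable [InnerProductSpace ℝ E] {g : ℝ → E → E} {T τ : ℝ} {ξ ℓ : E}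

lemma exists_norm_sub_sub_time_le
    (hg : ContDiffOn ℝ 2 (Function.uncurry g) (Icc 0 T ×ˢ univ)) (hτ : τ ∈ Ioo 0 T) {η : ℝ}
    (hη : 0 < η) : ∃ r > 0, ∀ t t' : ℝ, |t - τ| ≤ r → |t' - τ| ≤ r →
      ∀ x ∈ Metric.closedBall ξ r, ∀ y ∈ Metric.closedBall ξ r,
        ‖g t x - g t' y - ((t - t') • deriv (fun s => g s ξ) τ + fderiv ℝ (g τ) ξ (x - y))‖
          ≤ η * (|t - t'| + ‖x - y‖) := by
  have hst := (contDiffAt_of_contDiffOn_uncurry hg hτ ξ).hasStrictFDerivAt two_ne_zero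
  set D := fderiv ℝ (Function.uncurry g) (τ, ξ) with hD
  have hA : fderiv ℝ (g τ) ξ = D.comp (ContinuousLinearMap.inr ℝ ℝ E) := by
    have h1 := hst.hasFDerivAt.comp ξ (hasFDerivAt_prodMk_right τ ξ)
    exact h1.fderiv
  have hγ : deriv (fun s => g s ξ) τ = D (1, 0) := by
    have h1 := hst.hasFDerivAt.comp_hasDerivAt τ
      ((hasDerivAt_id τ).prodMk (hasDerivAt_const τ ξ))
    exact h1.deriv
  obtain ⟨r, hr, hball⟩ := Metric.nhds_basis_closedBall.eventually_iff.1 (hst.isLittleO.def hη)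
  refine ⟨r, hr, fun t t' ht ht' x hx y hy => ?_⟩
  have h1 := hball (x := ((t, x), (t', y))) (by
    rw [Metric.mem_closedBall] at hx hy ⊢
    simp only [Prod.dist_eq, Real.dist_eq]
    exact max_le (max_le ht hx) (max_le ht' hy))
  have h2 : D ((t, x) - (t', y)) = (t - t') • deriv (fun s => g s ξ) τ + fderiv ℝ (g τ) ξ (x - y) := by
    rw [hA, hγ, ← map_smul, ContinuousLinearMap.comp_apply, ← map_add]
    simp
  simp only [Function.uncurry, h2] at h1
  refine h1.trans (mul_le_mul_of_nonneg_left ?_ hη.le)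
  rw [Prod.norm_def]
  exact max_le (le_add_of_nonneg_right (norm_nonneg _)) (le_add_of_nonneg_left (abs_nonneg _))

/-- The transversality conditions produce the quantitative saddle-node structure. -/
theorem exists_saddleNode [ProperSpace E]
    (hg : ContDiffOn ℝ 2 (Function.uncurry g) (Icc 0 T ×ˢ univ)) (hτ : τ ∈ Ioo 0 T)
    (hξ : g τ ξ = 0) (hsymm : ∀ p q, ⟪fderiv ℝ (g τ) ξ p, q⟫ = ⟪p, fderiv ℝ (g τ) ξ q⟫)
    (hpsd : ∀ p, 0 ≤ ⟪fderiv ℝ (g τ) ξ p, p⟫) (hℓ : ‖ℓ‖ = 1)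
    (hker : LinearMap.ker (fderiv ℝ (g τ) ξ : E →ₗ[ℝ] E) = Submodule.span ℝ {ℓ})
    (hβ : ⟪deriv (fun s => g s ξ) τ, ℓ⟫ ≠ 0)
    (hquad : fderiv ℝ (fderiv ℝ fun x => ⟪g τ x, ℓ⟫) ξ ℓ ℓ < 0) :
    ∃ κ r δ₀ c₁ C₁ c C, SaddleNode g T τ ξ ℓ κ r δ₀ c₁ C₁ c C (-⟪deriv (fun s => g s ξ) τ, ℓ⟫) := by
  set A := fderiv ℝ (g τ) ξ with hAdef
  set γ := deriv (fun s => g s ξ) τ with hγ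
  have hAℓ : ∀ p, ⟪A p, ℓ⟫ = 0 := by
    intro p
    have : ℓ ∈ LinearMap.ker (A : E →ₗ[ℝ] E) := hker ▸ Submodule.mem_span_singleton_self ℓ
    have : A ℓ = 0 := by simpa using this
    rw [hsymm, this, inner_zero_right]
  obtain ⟨lam, hlam, hA⟩ := exists_pos_mul_le_of_ker_eq_span hsymm hpsd hℓ hker
  have hgτ : ContDiff ℝ 2 (g τ) := contDiff_of_contDiffOn_uncurry hg (Ioo_subset_Icc_self hτ)
  set Φ : E → ℝ := fun x => ⟪g τ x, ℓ⟫ with hΦ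
  have hΦ2 : ContDiff ℝ 2 Φ := hgτ.inner ℝ contDiff_const
  have hΦ0 : fderiv ℝ Φ ξ = 0 := by
    ext p
    have h1 := ((hgτ.differentiable two_ne_zero ξ).hasFDerivAt.inner ℝ (hasFDerivAt_const ℓ ξ)).fderiv
    rw [h1]
    simpa using hAℓ p
  set B := fderiv ℝ (fderiv ℝ Φ) ξ with hB
  set b := -B ℓ ℓ with hb
  have hb0 : 0 < b := by rw [hb]; linarith
  obtain ⟨r₁, hr₁, htaylor⟩ := exists_abs_sub_le_of_fderiv_eq_zero hΦ2 hΦ0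
    (show 0 < b / 8 by linarith)
  set C := (‖B‖ + 2 * ‖B‖ ^ 2 / b) / 2 + b / 8 with hC
  have hCpos : 0 < C := by positivity
  set κ := 1 + min 1 (b / 8 / (2 * C)) with hκ
  have hκ1 : 1 < κ := by
    have : 0 < min 1 (b / 8 / (2 * C)) := lt_min one_pos (by positivity)
    linarith
  have hκ2 : κ ≤ 2 := by linarith [min_le_left 1 (b / 8 / (2 * C))]
  have hκC : C * (κ - 1) ≤ b / 16 := by
    calc C * (κ - 1) ≤ C * (b / 8 / (2 * C)) := by
          gcongr
          linarith [min_le_right 1 (b / 8 / (2 * C))]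
      _ = b / 16 := by field_simp; norm_num
  have hκi : 0 < 1 - 1 / κ := by
    rw [sub_pos, div_lt_one (by linarith)]; exact hκ1
  have hκpos : 0 < 1 + κ := by linarith
  set η := lam * (1 - 1 / κ) / (2 * (1 + κ)) with hη
  have hηpos : 0 < η := by positivity
  have hβ0 : 0 < |-⟪γ, ℓ⟫| := abs_pos.2 (neg_ne_zero.2 hβ)
  obtain ⟨r₂, hr₂, hlin⟩ := exists_norm_sub_sub_time_le (ξ := ξ) hg hτ
    (lt_min hηpos (half_pos hβ0))
  set r := min r₁ r₂ with hr
  have hrpos : 0 < r := lt_min hr₁ hr₂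
  set δ₀ := min r₂ (min (τ / 2) ((T - τ) / 2)) with hδ₀
  have hδ₀pos : 0 < δ₀ := by
    have := hτ.1; have := hτ.2
    exact lt_min hr₂ (lt_min (by linarith) (by linarith))
  have hsub : Metric.closedBall ξ r ⊆ Metric.closedBall ξ r₂ :=
    Metric.closedBall_subset_closedBall (min_le_right _ _)
  refine ⟨κ, r, δ₀, lam * (1 - 1 / κ) / 2, (1 + κ) * (‖γ‖ + η), b / 16, C, hℓ, hκ1, hκ2, hrpos,
    hδ₀pos, by positivity, by positivity, by positivity, hCpos, neg_ne_zero.2 hβ, ?_, ?_, hξ,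
    ?_, ?_⟩
  · have : δ₀ ≤ τ / 2 := (min_le_right _ _).trans (min_le_left _ _)
    linarith [hτ.1]
  · have : δ₀ ≤ (T - τ) / 2 := (min_le_right _ _).trans (min_le_right _ _)
    linarith [hτ.2]
  · intro t ht x hx y hy hQ
    have h1 := hlin t τ (ht.trans (min_le_left _ _)) (by simpa using hr₂.le) x (hsub hx) y (hsub hy)
    have h2 : ‖g t x - g τ y - A (x - y)‖ ≤ η * ‖x - y‖ + (‖γ‖ + η) * |t - τ| := by
      calc ‖g t x - g τ y - A (x - y)‖
          = ‖(g t x - g τ y - ((t - τ) • γ + A (x - y))) + (t - τ) • γ‖ := by congr 1; abel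
        _ ≤ ‖g t x - g τ y - ((t - τ) • γ + A (x - y))‖ + ‖(t - τ) • γ‖ := norm_add_le _ _
        _ ≤ η * (|t - τ| + ‖x - y‖) + |t - τ| * ‖γ‖ := by
            rw [norm_smul, Real.norm_eq_abs]
            gcongr
            exact h1.trans (by gcongr; exact min_le_left _ _)
        _ = _ := by ring
    have h3 := le_inner_add_of_coneForm_nonneg hℓ hκ1 hlam hA hAℓ h2 hQ
    rw [add_sub_cancel] at h3
    have h4 : (1 + κ) * η = lam * (1 - 1 / κ) / 2 := by rw [hη]; field_simp
    rw [h4] at h3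
    linarith
  · intro t ht x hx ρ hQ
    set p := x - ξ with hp
    set z := ⟪p, ℓ⟫ with hz
    set w := p - z • ℓ with hw
    have hℓℓ : ⟪ℓ, ℓ⟫ = 1 := by rw [real_inner_self_eq_norm_sq, hℓ, one_pow]
    have hwn : ‖w‖ ^ 2 = ‖p‖ ^ 2 - z ^ 2 := by
      rw [hw, norm_sub_sq_real, norm_smul, real_inner_smul_right, hℓ, mul_one, Real.norm_eq_abs,
        sq_abs, ← hz]
      ring
    have hw2 : ‖w‖ ^ 2 ≤ (κ - 1) * z ^ 2 + ρ ^ 2 := by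
      unfold coneForm at hQ; rw [hwn]; linarith
    have hpn : ‖p‖ ≤ r₁ := by
      rw [mem_closedBall_iff_norm] at hx
      exact hx.trans (min_le_left _ _)
    have h1 := (abs_le.1 (htaylor p hpn)).2
    rw [show ξ + p = x by rw [hp]; abel] at h1
    have hΦξ : Φ ξ = 0 := by simp [hΦ, hξ]
    have hBle : ∀ a c, |B a c| ≤ ‖B‖ * ‖a‖ * ‖c‖ := fun a c => B.le_opNorm₂ a c
    have h2 : B p p = z ^ 2 * B ℓ ℓ + z * (B ℓ w + B w ℓ) + B w w := by
      have : p = z • ℓ + w := by rw [hw]; abel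
      rw [this]
      simp only [map_add, map_smul, _root_.add_apply, _root_.smul_apply, smul_eq_mul]
      ring
    have h3 : B p p ≤ -(b / 2) * z ^ 2 + (‖B‖ + 2 * ‖B‖ ^ 2 / b) * ‖w‖ ^ 2 := by
      have e1 := (abs_le.1 (hBle w w)).2
      have e2 : z * (B ℓ w + B w ℓ) ≤ |z| * (2 * ‖B‖ * ‖w‖) := by
        refine (le_abs_self _).trans ?_
        rw [abs_mul]
        gcongr
        refine (abs_add_le _ _).trans ?_
        have e3 := hBle ℓ w
        have e4 := hBle w ℓ
        rw [hℓ] at e3 e4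
        linarith
      have e5 : |z| * (2 * ‖B‖ * ‖w‖) ≤ b / 2 * z ^ 2 + 2 * ‖B‖ ^ 2 / b * ‖w‖ ^ 2 := by
        have e6 : b / 2 * z ^ 2 + 2 * ‖B‖ ^ 2 / b * ‖w‖ ^ 2 - |z| * (2 * ‖B‖ * ‖w‖)
            = (b * |z| - 2 * ‖B‖ * ‖w‖) ^ 2 / (2 * b) := by
          rw [← sq_abs z]; field_simp; ring
        have e7 : 0 ≤ (b * |z| - 2 * ‖B‖ * ‖w‖) ^ 2 / (2 * b) := by positivity
        linarith
      rw [h2, show B ℓ ℓ = -b by rw [hb]; ring]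
      linarith
    have h4 : b / 16 * z ^ 2 - C * ρ ^ 2 ≤ -Φ x := by
      have e1 : b / 8 * z ^ 2 - C * ‖w‖ ^ 2 ≤ -Φ x := by
        rw [hC]
        have : ‖p‖ ^ 2 = z ^ 2 + ‖w‖ ^ 2 := by rw [hwn]; ring
        rw [this] at h1
        linarith
      have e2 : C * ‖w‖ ^ 2 ≤ b / 16 * z ^ 2 + C * ρ ^ 2 := by
        calc C * ‖w‖ ^ 2 ≤ C * ((κ - 1) * z ^ 2 + ρ ^ 2) := by gcongr
          _ = C * (κ - 1) * z ^ 2 + C * ρ ^ 2 := by ring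
          _ ≤ _ := by gcongr
      linarith
    have h5 := hlin t τ (ht.trans (min_le_left _ _)) (by simpa using hr₂.le) x (hsub hx) x (hsub hx)
    have h6 := real_inner_le_norm (g t x - g τ x - ((t - τ) • γ + A (x - x))) ℓ
    rw [hℓ, mul_one] at h6
    replace h6 := h6.trans h5
    simp only [sub_self, map_zero, add_zero, norm_zero, inner_sub_left, real_inner_smul_left] at h6
    have h7 : min η (|-⟪γ, ℓ⟫| / 2) * |t - τ| ≤ |-⟪γ, ℓ⟫| / 2 * |t - τ| := by
      gcongr; exact min_le_right _ _
    simp only [hΦ] at h4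
    linarith

end SaddleNodeConstruction

section Transition

variable {E : Type*} [NormedAddCommGroup E] [InnerProductSpace ℝ E] [ProperSpace E]
  {g : ℝ → E → E} {T τ : ℝ}

lemma exists_lipschitzOnWith_closedBall
    (hg : ContDiffOn ℝ 2 (Function.uncurry g) (Icc 0 T ×ˢ univ)) (hτ : τ ∈ Icc 0 T) (R : ℝ) :
    ∃ L, LipschitzOnWith L (g τ) (Metric.closedBall 0 R) :=
  (((contDiff_of_contDiffOn_uncurry hg hτ).of_le one_le_two).locallyLipschitz.locallyLipschitzOn
    ).exists_lipschitzOnWith_of_compact (isCompact_closedBall 0 R)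

lemma exists_forall_norm_sub_le_closedBall
    (hg : ContDiffOn ℝ 2 (Function.uncurry g) (Icc 0 T ×ˢ univ)) (hτ : τ ∈ Icc 0 T) (R : ℝ)
    {η : ℝ} (hη : 0 < η) : ∃ δ > 0, ∀ t ∈ Icc 0 T, |t - τ| ≤ δ →
      ∀ x ∈ Metric.closedBall (0 : E) R, ‖g t x - g τ x‖ ≤ η := by
  have hcpt : IsCompact (Icc 0 T ×ˢ Metric.closedBall (0 : E) R) :=
    isCompact_Icc.prod (isCompact_closedBall _ _)
  have huc := hcpt.uniformContinuousOn_of_continuous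
    (hg.continuousOn.mono (prod_mono_right (subset_univ _)))
  obtain ⟨δ, hδ, h⟩ := Metric.uniformContinuousOn_iff_le.1 huc η hη
  refine ⟨δ, hδ, fun t ht htτ x hx => ?_⟩
  have := h (t, x) ⟨ht, hx⟩ (τ, x) ⟨hτ, hx⟩ (by
    rw [Prod.dist_eq, dist_self, Real.dist_eq]
    exact max_le htτ hδ.le)
  rwa [dist_eq_norm] at this

variable {ξ ℓ : E} {κ r δ₀ c₁ C₁ c C β : ℝ} {uε : ℝ → ℝ → E}

/-- Shortly after passing a saddle-node, fast solutions are close to the endpoint of the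
heteroclinic orbit emanating from it. -/
theorem SaddleNode.exists_eventually_near_endpoint
    (S : SaddleNode g T τ ξ ℓ κ r δ₀ c₁ C₁ c C β)
    (hg : ContDiffOn ℝ 2 (Function.uncurry g) (Icc 0 T ×ˢ univ)) {u : ℝ → E}
    (hu : Tendsto u (𝓝[<] τ) (𝓝 ξ)) (hcrit : ∀ᶠ t in 𝓝[<] τ, g t (u t) = 0)
    {v : ℝ → E} (hv : ∀ s, HasDerivAt v (-g τ (v s)) s) (hne : ∃ s₁ s₂, v s₁ ≠ v s₂)
    (hbot : Tendsto v atBot (𝓝 ξ)) {y : E} (htop : Tendsto v atTop (𝓝 y)) (hy : g τ y = 0)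
    (hpd : ∀ p, p ≠ 0 → 0 < ⟪fderiv ℝ (g τ) y p, p⟫)
    (hsol : ∀ ε > 0, IsFastSol g T ε (uε ε)) {R₀ : ℝ}
    (hbd : ∀ R ≥ R₀, ∀ᶠ ε in 𝓝[>] (0 : ℝ), ∀ t ∈ Icc 0 T, uε ε t ∈ Metric.closedBall 0 R)
    {a₀ : ℝ} (ha₀ : a₀ < τ) (hconv : ∀ a b, a₀ < a → b < τ → ∀ ρ > 0, ∀ᶠ ε in 𝓝[>] (0 : ℝ),
      ∀ s ∈ Icc a b, ‖uε ε s - u s‖ ≤ ρ) {ρ₀ : ℝ} (hρ₀ : 0 < ρ₀) :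
    ∃ h > 0, ∀ h' > 0, ∀ᶠ ε in 𝓝[>] (0 : ℝ), ∀ s ∈ Icc (τ + h') (τ + h),
      ‖uε ε s - y‖ ≤ ρ₀ := by
  have hτ : τ ∈ Ioo 0 T :=
    ⟨by linarith [S.lt_sub, S.δ₀_pos], by linarith [S.add_lt, S.δ₀_pos]⟩
  have hτ' : τ ∈ Icc 0 T := Ioo_subset_Icc_self hτ
  have hT : 0 < T := hτ.1.trans hτ.2
  have hvc : Continuous v := continuous_iff_continuousAt.2 fun s => (hv s).continuousAt
  obtain ⟨ρ, hρ, hρρ₀, h, hh, htrap⟩ := exists_trap_of_posDef hT hg hτ' hy hpd hρ₀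
  obtain ⟨s₀, hs₀⟩ := eventually_atBot.1
    (hbot (Metric.closedBall_mem_nhds ξ (half_pos S.r_pos)))
  have hvs₀ : v s₀ ≠ ξ := by
    intro hcon
    obtain ⟨s₁, s₂, h12⟩ := hne
    have := eq_of_orbit_apply_eq (exists_lipschitzOnWith_closedBall hg hτ') hv S.crit hcon
    exact h12 ((this s₁).trans (this s₂).symm)
  obtain ⟨s₁, hs₁, hs₀₁⟩ := ((htop.eventually (Metric.closedBall_mem_nhds y (half_pos hρ))).and
    (eventually_ge_atTop s₀)).exists
  obtain ⟨R₁, hR₁⟩ := (isCompact_Icc (a := s₀) (b := s₁)).image hvc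
    |>.isBounded.subset_closedBall 0
  set R := max R₀ R₁
  obtain ⟨L, hL⟩ := exists_lipschitzOnWith_closedBall hg hτ' R
  have hnear := fun (ρ' : ℝ) (hρ' : 0 < ρ') (h' : ℝ) (hh' : 0 < h') =>
    S.eventually_exists_near_orbit (S.β_pos hu hcrit) hv hbot hs₀ hvs₀ hu hsol ha₀ hconv hρ' hh'
  refine ⟨min h (T - τ), lt_min hh (sub_pos.2 hτ.2), fun h' hh' => ?_⟩
  have hnear₁ := eventually_exists_near_orbit_of_le hL hτ
    (fun η hη => exists_forall_norm_sub_le_closedBall hg hτ' R hη) hv hs₀₁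
    (fun s hs => Metric.closedBall_subset_closedBall (le_max_right _ _) (hR₁ ⟨s, hs, rfl⟩)) hsol
    (hbd R (le_max_left _ _)) hnear (half_pos hρ) (lt_min hh' (lt_min hh hτ.1))
  filter_upwards [self_mem_nhdsWithin, hnear₁] with ε hε ⟨t, ht, hUt⟩ s hs
  rw [abs_le] at ht
  have e1 : min h' (min h τ) ≤ h' := min_le_left _ _
  have e2 : min h' (min h τ) ≤ h := (min_le_right _ _).trans (min_le_left _ _)
  have e3 : min h' (min h τ) ≤ τ := (min_le_right _ _).trans (min_le_right _ _)
  have e4 : min h (T - τ) ≤ h := min_le_left _ _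
  have e5 : min h (T - τ) ≤ T - τ := min_le_right _ _
  refine (htrap ε hε (uε ε) (hsol ε hε) t (τ + min h (T - τ)) (by linarith) (by linarith)
    (by linarith) (by linarith) ?_ s ⟨by linarith [hs.1], hs.2⟩).trans hρρ₀
  rw [dist_eq_norm] at hs₁
  calc ‖uε ε t - y‖ = ‖(uε ε t - v s₁) + (v s₁ - y)‖ := by congr 1; abel
    _ ≤ ‖uε ε t - v s₁‖ + ‖v s₁ - y‖ := norm_add_le _ _
    _ ≤ ρ := by linarith

/-- A branch of nondegenerate stable equilibria, of class `C²`, over the interval `[p, q)`. -/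
structure IsStableBranch (g : ℝ → E → E) (p q : ℝ) (u : ℝ → E) : Prop where
  contDiffOn : ContDiffOn ℝ 2 u (Ico p q)
  crit : ∀ s ∈ Ico p q, g s (u s) = 0
  posDef : ∀ s ∈ Ico p q, ∀ x, x ≠ 0 → 0 < ⟪fderiv ℝ (g s) (u s) x, x⟫

variable {u : ℝ → E} {p q : ℝ}

lemma IsStableBranch.exists_follow (hu : IsStableBranch g p q u) (hT : 0 < T)
    (hg : ContDiffOn ℝ 2 (Function.uncurry g) (Icc 0 T ×ˢ univ)) (hp : 0 ≤ p) (hq : q ≤ T)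
    (hsol : ∀ ε > 0, IsFastSol g T ε (uε ε)) {b : ℝ} (hb : b < q) {ρ₀ : ℝ} (hρ₀ : 0 < ρ₀) :
    ∃ ρ > 0, ∀ a ∈ Icc p b, (∀ᶠ ε in 𝓝[>] (0 : ℝ), ‖uε ε a - u a‖ ≤ ρ) →
      ∀ᶠ ε in 𝓝[>] (0 : ℝ), ∀ s ∈ Icc a b, ‖uε ε s - u s‖ ≤ ρ₀ := by
  rcases le_or_gt b p with hpb | hpb
  · refine ⟨ρ₀, hρ₀, fun a ha h => h.mono fun ε hε s hs => ?_⟩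
    have : s = a := le_antisymm (hs.2.trans (hpb.trans ha.1)) hs.1
    rwa [this]
  have hsub : Icc p b ⊆ Ico p q := fun s hs => ⟨hs.1, hs.2.trans_lt hb⟩
  have hud : UniqueDiffOn ℝ (Ico p q) := uniqueDiffOn_Ico p q
  have hcd : ContinuousOn (derivWithin u (Ico p q)) (Icc p b) :=
    (hu.contDiffOn.continuousOn_derivWithin hud one_le_two).mono hsub
  obtain ⟨M, hM⟩ := isCompact_Icc.exists_bound_of_continuousOn hcd
  obtain ⟨ρ, hρ, hρρ₀, h⟩ := exists_follow_branch (u' := derivWithin u (Ico p q)) hT hg hp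
    (hb.le.trans hq) (hu.contDiffOn.continuousOn.mono hsub)
    (fun s hs => by
      have hs' := hsub (Ico_subset_Icc_self hs)
      exact ((hu.contDiffOn.differentiableOn two_ne_zero) s hs').hasDerivWithinAt
        |>.mono_of_mem_nhdsWithin (mem_of_superset (Ico_mem_nhdsGE hs'.2)
          (Ico_subset_Ico_left hs'.1)))
    (fun s hs => hM s (Ico_subset_Icc_self hs)) (fun s hs => hu.crit s (hsub hs))
    (fun s hs => hu.posDef s (hsub hs)) hρ₀
  refine ⟨ρ, hρ, fun a ha hstart => ?_⟩
  filter_upwards [self_mem_nhdsWithin, h, hstart] with ε hε h hstart s hs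
  exact (h (uε ε) (hsol ε hε) a ha hstart s hs).trans hρρ₀

/-- If fast solutions get close to the initial point of a stable branch shortly after the initial
time, then they converge to the branch. -/
lemma IsStableBranch.eventually_norm_sub_le (hu : IsStableBranch g p q u) (hT : 0 < T)
    (hg : ContDiffOn ℝ 2 (Function.uncurry g) (Icc 0 T ×ˢ univ)) (hp : 0 ≤ p) (hpq : p < q)
    (hq : q ≤ T) (hsol : ∀ ε > 0, IsFastSol g T ε (uε ε))
    (harr : ∀ ρ > 0, ∃ h > 0, ∀ h' > 0, ∀ᶠ ε in 𝓝[>] (0 : ℝ), ∀ s ∈ Icc (p + h') (p + h),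
      ‖uε ε s - u p‖ ≤ ρ) {a b : ℝ} (ha : p < a) (hb : b < q) {ρ₀ : ℝ} (hρ₀ : 0 < ρ₀) :
    ∀ᶠ ε in 𝓝[>] (0 : ℝ), ∀ s ∈ Icc a b, ‖uε ε s - u s‖ ≤ ρ₀ := by
  rcases lt_or_ge b a with hba | hab
  · exact Eventually.of_forall fun ε s hs => absurd (hs.1.trans hs.2) (not_le.2 hba)
  obtain ⟨ρ, hρ, h⟩ := hu.exists_follow hT hg hp hq hsol hb hρ₀
  obtain ⟨h₁, hh₁, harr⟩ := harr (ρ / 2) (half_pos hρ)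
  have hcont : ContinuousWithinAt u (Ioi p) p :=
    (hu.contDiffOn.continuousOn p ⟨le_rfl, hpq⟩).mono_of_mem_nhdsWithin
      (mem_of_superset (Ioo_mem_nhdsGT hpq) Ioo_subset_Ico_self)
  have hnear : ∀ᶠ s in 𝓝[>] p, u s ∈ Metric.closedBall (u p) (ρ / 2) :=
    hcont (Metric.closedBall_mem_nhds _ (half_pos hρ))
  obtain ⟨s₀, hs₀, hs₀p, hs₀a⟩ := (hnear.and
    (Ioo_mem_nhdsGT (lt_min ha (show p < p + h₁ by linarith)))).exists
  rw [Metric.mem_closedBall, dist_eq_norm] at hs₀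
  rw [lt_min_iff] at hs₀a
  have hstart : ∀ᶠ ε in 𝓝[>] (0 : ℝ), ‖uε ε s₀ - u s₀‖ ≤ ρ := by
    filter_upwards [harr (s₀ - p) (sub_pos.2 hs₀p)] with ε hε
    have h1 := hε s₀ ⟨by linarith, hs₀a.2.le⟩
    calc ‖uε ε s₀ - u s₀‖ = ‖(uε ε s₀ - u p) - (u s₀ - u p)‖ := by congr 1; abel
      _ ≤ ‖uε ε s₀ - u p‖ + ‖u s₀ - u p‖ := norm_sub_le _ _
      _ ≤ ρ := by linarith
  filter_upwards [h s₀ ⟨hs₀p.le, hs₀a.1.le.trans hab⟩ hstart] with ε hε s hs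
  exact hε s ⟨hs₀a.1.le.trans hs.1, hs.2⟩

/-- If a stable branch over `[p, T)` has a stable limit at the final time, the convergence of fast
solutions is uniform up to the final time. -/
lemma exists_eventually_norm_sub_le_endpoint (hT : 0 < T)
    (hg : ContDiffOn ℝ 2 (Function.uncurry g) (Icc 0 T ×ˢ univ))
    (hsol : ∀ ε > 0, IsFastSol g T ε (uε ε)) {ξ : E} (hξ : g T ξ = 0)
    (hpd : ∀ p, p ≠ 0 → 0 < ⟪fderiv ℝ (g T) ξ p, p⟫) (hu : Tendsto u (𝓝[<] T) (𝓝 ξ))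
    (huT : u T = ξ) (hp : 0 ≤ p) (hpT : p < T)
    (hconv : ∀ a b, p < a → b < T → ∀ ρ > 0, ∀ᶠ ε in 𝓝[>] (0 : ℝ),
      ∀ s ∈ Icc a b, ‖uε ε s - u s‖ ≤ ρ) {ρ₀ : ℝ} (hρ₀ : 0 < ρ₀) :
    ∃ a < T, ∀ᶠ ε in 𝓝[>] (0 : ℝ), ∀ s ∈ Icc a T, ‖uε ε s - u s‖ ≤ ρ₀ := by
  obtain ⟨ρ, hρ, hρρ₀, h, hh, htrap⟩ :=
    exists_trap_of_posDef hT hg (right_mem_Icc.2 hT.le) hξ hpd (half_pos hρ₀)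
  obtain ⟨a₁, ha₁, hu₁⟩ := mem_nhdsLT_iff_exists_Ioo_subset.1
    (hu (Metric.closedBall_mem_nhds ξ (half_pos hρ)))
  rw [mem_Iio] at ha₁
  obtain ⟨a, haM, haT⟩ := exists_between (max_lt ha₁ (max_lt hpT (show T - h < T by linarith)))
  rw [max_lt_iff, max_lt_iff] at haM
  have hus : ∀ s ∈ Icc a T, ‖u s - ξ‖ ≤ ρ / 2 := by
    intro s hs
    rcases hs.2.eq_or_lt with h1 | h1
    · rw [h1, huT, sub_self, norm_zero]; exact (half_pos hρ).le
    · have := hu₁ ⟨haM.1.trans_le hs.1, h1⟩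
      rwa [mem_preimage, Metric.mem_closedBall, dist_eq_norm] at this
  refine ⟨a, haT, ?_⟩
  filter_upwards [self_mem_nhdsWithin, hconv a a haM.2.1 haT (ρ / 2) (half_pos hρ)]
    with ε hε hstart s hs
  have h1 := hstart a ⟨le_rfl, le_rfl⟩
  have h2 := hus a ⟨le_rfl, haT.le⟩
  have h3 := htrap ε hε (uε ε) (hsol ε hε) a T (hp.trans haM.2.1.le) le_rfl
    haM.2.2.le (by linarith) (by
      calc ‖uε ε a - ξ‖ = ‖(uε ε a - u a) + (u a - ξ)‖ := by congr 1; abel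
        _ ≤ ‖uε ε a - u a‖ + ‖u a - ξ‖ := norm_add_le _ _
        _ ≤ ρ := by linarith) s hs
  calc ‖uε ε s - u s‖ = ‖(uε ε s - ξ) - (u s - ξ)‖ := by congr 1; abel
    _ ≤ ‖uε ε s - ξ‖ + ‖u s - ξ‖ := norm_sub_le _ _
    _ ≤ ρ₀ := by linarith [hus s hs]

end Transition

section GradientCalculus

variable {E : Type*} [NormedAddCommGroup E] [InnerProductSpace ℝ E] [CompleteSpace E]

lemma inner_gradient_eq_fderiv (F : E → ℝ) (x q : E) : ⟪gradient F x, q⟫ = fderiv ℝ F x q := by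
  simp [gradient]

lemma inner_fderiv_gradient {F : E → ℝ} {x : E} (hF : ContDiffAt ℝ 2 F x) (p q : E) :
    ⟪fderiv ℝ (gradient F) x p, q⟫ = fderiv ℝ (fderiv ℝ F) x p q := by
  have hF1 : ContDiffAt ℝ 1 (fderiv ℝ F) x := hF.fderiv_right (by norm_num)
  have hg : DifferentiableAt ℝ (gradient F) x :=
    ((InnerProductSpace.toDual ℝ E).symm.contDiff.contDiffAt.comp x hF1).differentiableAt
      one_ne_zero
  have h1 := hg.hasFDerivAt.inner ℝ (hasFDerivAt_const q x)
  have h2 := (ContinuousLinearMap.apply ℝ ℝ q).hasFDerivAt.comp x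
    (hF1.differentiableAt one_ne_zero).hasFDerivAt
  have h3 := h1.unique (h2.congr_of_eventuallyEq
    (Eventually.of_forall fun y => inner_gradient_eq_fderiv F y q))
  simpa using DFunLike.congr_fun h3 p

lemma inner_fderiv_gradient_comm {F : E → ℝ} {x : E} (hF : ContDiffAt ℝ 2 F x) (p q : E) :
    ⟪fderiv ℝ (gradient F) x p, q⟫ = ⟪p, fderiv ℝ (gradient F) x q⟫ := by
  rw [real_inner_comm _ p, inner_fderiv_gradient hF, inner_fderiv_gradient hF]
  exact (hF.isSymmSndFDerivAt (by simp)) p q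

lemma fderiv_fderiv_inner_gradient {F : E → ℝ} (hF : ContDiff ℝ 3 F) (x ℓ : E) :
    fderiv ℝ (fderiv ℝ fun y => ⟪gradient F y, ℓ⟫) x ℓ ℓ =
      iteratedFDeriv ℝ 3 F x ![ℓ, ℓ, ℓ] := by
  have h1 : ContDiff ℝ 2 (fderiv ℝ F) := hF.fderiv_right (by norm_num)
  have h2 : ContDiff ℝ 1 (fderiv ℝ (fderiv ℝ F)) := h1.fderiv_right (by norm_num)
  have hL : (fderiv ℝ fun y => ⟪gradient F y, ℓ⟫) =
      fun y => (ContinuousLinearMap.apply ℝ ℝ ℓ).comp (fderiv ℝ (fderiv ℝ F) y) := by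
    ext1 y
    simp_rw [inner_gradient_eq_fderiv]
    exact ((ContinuousLinearMap.apply ℝ ℝ ℓ).hasFDerivAt.comp y
      ((h1.differentiable two_ne_zero) y).hasFDerivAt).fderiv
  have h3 : HasFDerivAt (fun y => (ContinuousLinearMap.apply ℝ ℝ ℓ).comp
      (fderiv ℝ (fderiv ℝ F) y)) _ x :=
    (hasFDerivAt_const (ContinuousLinearMap.apply ℝ ℝ ℓ) x).clm_comp
      ((h2.differentiable one_ne_zero) x).hasFDerivAt
  rw [hL, h3.fderiv, iteratedFDeriv_succ_apply_right]
  have := iteratedFDeriv_two_apply (𝕜 := ℝ) (fderiv ℝ F) x ![ℓ, ℓ]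
  simp only [Matrix.cons_val_zero, Matrix.cons_val_one] at this
  have e : Fin.init ![ℓ, ℓ, ℓ] = ![ℓ, ℓ] := by
    ext i : 1; fin_cases i <;> rfl
  rw [e, this]
  simp [Fin.last]

variable {f : ℝ → E → ℝ} {T : ℝ}

/-- At an interior time, spatial gradient and time derivative commute. -/
lemma inner_gradient_deriv_comm (hT : 0 < T)
    (hf : ContDiffOn ℝ 3 (Function.uncurry f) (Icc 0 T ×ˢ univ)) {τ : ℝ} (hτ : τ ∈ Ioo 0 T)
    (ξ ℓ : E) :
    ⟪gradient (fun z => deriv (fun s => f s z) τ) ξ, ℓ⟫ =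
      ⟪deriv (fun s => gradient (f s) ξ) τ, ℓ⟫ := by
  set F := Function.uncurry f
  have hFat : ∀ z, ContDiffAt ℝ 3 F (τ, z) := fun z => contDiffAt_of_contDiffOn_uncurry hf hτ z
  have hF2 : HasFDerivAt (fderiv ℝ F) (fderiv ℝ (fderiv ℝ F) (τ, ξ)) (τ, ξ) :=
    (((hFat ξ).fderiv_right (m := 2) (by norm_num)).differentiableAt two_ne_zero).hasFDerivAt
  have hsymm : IsSymmSndFDerivAt ℝ F (τ, ξ) := ((hFat ξ).of_le (by norm_num)).isSymmSndFDerivAt (n := 2) (by simp)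
  have hpart : ∀ z, deriv (fun s => f s z) τ = fderiv ℝ F (τ, z) (1, 0) := fun z => by
    have h1 : HasDerivAt (fun s : ℝ => (s, z)) ((1 : ℝ), (0 : E)) τ :=
      (hasDerivAt_id τ).prodMk (hasDerivAt_const τ z)
    exact (((hFat z).differentiableAt three_ne_zero).hasFDerivAt.comp_hasDerivAt τ h1).deriv
  have hlhs : ⟪gradient (fun z => deriv (fun s => f s z) τ) ξ, ℓ⟫ =
      fderiv ℝ (fderiv ℝ F) (τ, ξ) (0, ℓ) (1, 0) := by
    rw [inner_gradient_eq_fderiv]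
    simp_rw [hpart]
    have h1 := (ContinuousLinearMap.apply ℝ ℝ ((1 : ℝ), (0 : E))).hasFDerivAt.comp ξ
      (hF2.comp ξ (hasFDerivAt_prodMk_right τ ξ))
    have h2 := h1.fderiv
    simp only [Function.comp_def, ContinuousLinearMap.apply_apply] at h2
    rw [h2]
    simp
  have hgd : DifferentiableAt ℝ (fun s => gradient (f s) ξ) τ := by
    have h1 := (contDiffAt_of_contDiffOn_uncurry (contDiffOn_uncurry_gradient hT hf) hτ ξ
      ).differentiableAt two_ne_zero
    exact h1.comp τ (f := fun s => (s, ξ)) (by fun_prop)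
  have hrhs : ⟪deriv (fun s => gradient (f s) ξ) τ, ℓ⟫ =
      fderiv ℝ (fderiv ℝ F) (τ, ξ) (1, 0) (0, ℓ) := by
    have h1 : HasDerivAt (fun s => ⟪gradient (f s) ξ, ℓ⟫)
        ⟪deriv (fun s => gradient (f s) ξ) τ, ℓ⟫ τ := by
      simpa using hgd.hasDerivAt.inner ℝ (hasDerivAt_const τ ℓ)
    have h2 : HasDerivAt (fun s : ℝ => (s, ξ)) ((1 : ℝ), (0 : E)) τ :=
      (hasDerivAt_id τ).prodMk (hasDerivAt_const τ ξ)
    have h3 : HasDerivAt (fun s => fderiv ℝ F (s, ξ) (0, ℓ))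
        (fderiv ℝ (fderiv ℝ F) (τ, ξ) (1, 0) (0, ℓ)) τ :=
      (ContinuousLinearMap.apply ℝ ℝ ((0 : ℝ), ℓ)).hasFDerivAt.comp_hasDerivAt τ
        (hF2.comp_hasDerivAt τ h2)
    refine h1.unique (h3.congr_of_eventuallyEq ?_)
    filter_upwards [Ioo_mem_nhds hτ.1 hτ.2] with s hs
    rw [inner_gradient_eq_fderiv]
    have h4 := (((contDiffAt_of_contDiffOn_uncurry hf hs ξ).differentiableAt
      three_ne_zero).hasFDerivAt.comp ξ (hasFDerivAt_prodMk_right s ξ)).fderiv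
    simp only [Function.comp_def, F, Function.uncurry] at h4 ⊢
    rw [h4]
    simp
  rw [hlhs, hrhs]
  exact hsymm _ _

end GradientCalculus

section Main

lemma exists_abs_mul_eq_one_and_pow_three_mul_neg {a b : ℝ} (ha : 0 < a) (hb : b ≠ 0) :
    ∃ c : ℝ, c ≠ 0 ∧ |c| * a = 1 ∧ c ^ 3 * b < 0 := by
  have ha' : 0 < a⁻¹ := inv_pos.2 ha
  have h3 : 0 < a⁻¹ ^ 3 := pow_pos ha' 3
  rcases lt_or_gt_of_ne hb with hb | hb
  · refine ⟨a⁻¹, ha'.ne', ?_, mul_neg_of_pos_of_neg h3 hb⟩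
    rw [abs_of_pos ha', inv_mul_cancel₀ ha.ne']
  · refine ⟨-a⁻¹, neg_ne_zero.2 ha'.ne', ?_, ?_⟩
    · rw [abs_neg, abs_of_pos ha', inv_mul_cancel₀ ha.ne']
    · have := mul_pos h3 hb
      nlinarith

/-- A degenerate critical point with the transversality conditions is a saddle-node of the
gradient field. -/
lemma exists_saddleNode_gradient {E : Type*} [NormedAddCommGroup E] [InnerProductSpace ℝ E]
    [ProperSpace E] {f : ℝ → E → ℝ} {T : ℝ} (hT : 0 < T)
    (hf : ContDiffOn ℝ 3 (Function.uncurry f) (Icc 0 T ×ˢ univ)) {τ : ℝ} (hτ : τ ∈ Ioo 0 T)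
    {ξ : E} (hξ : gradient (f τ) ξ = 0)
    (hpsd : ∀ p, 0 ≤ ⟪fderiv ℝ (gradient (f τ)) ξ p, p⟫) {ℓ₀ : E} (hℓ₀ : ℓ₀ ≠ 0)
    (hker : LinearMap.ker (fderiv ℝ (gradient (f τ)) ξ : E →ₗ[ℝ] E) = Submodule.span ℝ {ℓ₀})
    (hβ : ⟪gradient (fun z => deriv (fun s => f s z) τ) ξ, ℓ₀⟫ ≠ 0)
    (hcubic : iteratedFDeriv ℝ 3 (f τ) ξ ![ℓ₀, ℓ₀, ℓ₀] ≠ 0) :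
    ∃ ℓ κ r δ₀ c₁ C₁ c C β,
      SaddleNode (fun t x => gradient (f t) x) T τ ξ ℓ κ r δ₀ c₁ C₁ c C β := by
  have hτ' : τ ∈ Icc 0 T := Ioo_subset_Icc_self hτ
  have hfτ : ContDiff ℝ 3 (f τ) := contDiff_of_contDiffOn_uncurry hf hτ'
  obtain ⟨c, hc0, hc1, hc3⟩ :=
    exists_abs_mul_eq_one_and_pow_three_mul_neg (norm_pos_iff.2 hℓ₀) hcubic
  obtain ⟨κ, r, δ₀, c₁, C₁, c', C, S⟩ :=
    exists_saddleNode (g := fun t x => gradient (f t) x) (ℓ := c • ℓ₀)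
      (contDiffOn_uncurry_gradient hT hf) hτ hξ
      (fun p q => inner_fderiv_gradient_comm
        ((hfτ.of_le (by norm_num)).contDiffAt) p q) hpsd (by rw [norm_smul, Real.norm_eq_abs, hc1])
      (by rw [Submodule.span_singleton_smul_eq (IsUnit.mk0 c hc0)]; exact hker)
      (by
        rw [← inner_gradient_deriv_comm hT hf hτ, inner_smul_right]
        exact mul_ne_zero hc0 hβ)
      (by
        rw [fderiv_fderiv_inner_gradient hfτ]
        have h1 := (iteratedFDeriv ℝ 3 (f τ) ξ).map_smul_univ (fun _ => c) ![ℓ₀, ℓ₀, ℓ₀]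
        have h2 : (fun i => c • ![ℓ₀, ℓ₀, ℓ₀] i) = ![c • ℓ₀, c • ℓ₀, c • ℓ₀] := by
          ext i : 1; fin_cases i <;> rfl
        rw [h2] at h1
        rw [h1]
        simpa using hc3)
  exact ⟨c • ℓ₀, κ, r, δ₀, c₁, C₁, c', C, _, S⟩

/-- The limit of stable critical points at the final time is a stable critical point, provided
it is nondegenerate. -/
lemma crit_and_posDef_of_tendsto {E : Type*} [NormedAddCommGroup E] [InnerProductSpace ℝ E]
    [ProperSpace E] {f : ℝ → E → ℝ} {T : ℝ} (hT : 0 < T)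
    (hf : ContDiffOn ℝ 3 (Function.uncurry f) (Icc 0 T ×ˢ univ)) {u : ℝ → E} {ξ : E} {p : ℝ}
    (hp : 0 ≤ p) (hpT : p < T)
    (hu : IsStableBranch (fun t x => gradient (f t) x) p T u) (hlim : Tendsto u (𝓝[<] T) (𝓝 ξ))
    (hdet : gradient (f T) ξ = 0 →
      LinearMap.det (fderiv ℝ (gradient (f T)) ξ : E →ₗ[ℝ] E) ≠ 0) :
    gradient (f T) ξ = 0 ∧ ∀ q, q ≠ 0 → 0 < ⟪fderiv ℝ (gradient (f T)) ξ q, q⟫ := by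
  have hg := contDiffOn_uncurry_gradient hT hf
  have hTT : T ∈ Icc 0 T := right_mem_Icc.2 hT.le
  have hev : ∀ᶠ s in 𝓝[<] T, s ∈ Ico p T :=
    mem_of_superset (Ioo_mem_nhdsLT hpT) Ioo_subset_Ico_self
  have hpair : Tendsto (fun s => (s, u s)) (𝓝[<] T) (𝓝[Icc 0 T ×ˢ univ] (T, ξ)) := by
    refine tendsto_nhdsWithin_iff.2 ⟨?_, hev.mono fun s hs => ⟨⟨hp.trans hs.1, hs.2.le⟩, trivial⟩⟩
    exact (tendsto_id.mono_left nhdsWithin_le_nhds).prodMk_nhds hlim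
  have hcrit : gradient (f T) ξ = 0 := by
    have h1 : Tendsto (fun s => gradient (f s) (u s)) (𝓝[<] T) (𝓝 (gradient (f T) ξ)) :=
      (hg.continuousOn (T, ξ) ⟨hTT, trivial⟩).tendsto.comp hpair
    exact tendsto_nhds_unique (h1.congr' (hev.mono fun s hs => hu.crit s hs)) tendsto_const_nhds
  have hpsd : ∀ q, 0 ≤ ⟪fderiv ℝ (gradient (f T)) ξ q, q⟫ := by
    intro q
    have h1 : Tendsto (fun s => fderiv ℝ (gradient (f s)) (u s)) (𝓝[<] T)
        (𝓝 (fderiv ℝ (gradient (f T)) ξ)) :=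
      ((hg.fderiv_uncurry (m' := 1) hT (by norm_num)).continuousOn (T, ξ)
        ⟨hTT, trivial⟩).tendsto.comp hpair
    have h2 : Tendsto (fun s => ⟪fderiv ℝ (gradient (f s)) (u s) q, q⟫) (𝓝[<] T)
        (𝓝 ⟪fderiv ℝ (gradient (f T)) ξ q, q⟫) :=
      (((ContinuousLinearMap.apply ℝ E q).continuous.tendsto _).comp h1).inner tendsto_const_nhds
    refine ge_of_tendsto h2 (hev.mono fun s hs => ?_)
    rcases eq_or_ne q 0 with rfl | hq
    · simp
    · exact (hu.posDef s hs q hq).le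
  refine ⟨hcrit, fun q hq => (hpsd q).lt_of_ne' fun h0 => hdet hcrit ?_⟩
  have hF : ContDiffAt ℝ 2 (f T) ξ :=
    ((contDiff_of_contDiffOn_uncurry hf hTT).of_le (by norm_num)).contDiffAt
  have hz := apply_eq_zero_of_posSemidef (inner_fderiv_gradient_comm hF) hpsd h0
  by_contra hne
  have : FiniteDimensional ℝ E := FiniteDimensional.of_locallyCompactSpace ℝ
  have hinj := LinearMap.ker_eq_bot.1 (LinearMap.equivOfDetNeZero _ hne).ker
  exact hq (hinj (by simpa [LinearMap.equivOfDetNeZero] using hz))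

end Main

/-- Theorem `tm:main`, part 1: `u_ε → u` uniformly on every compact
subset of `[0,T] \ {t₁,…,t_{k−1}}` as `ε → 0⁺`. -/
theorem main_theorem_uniform_convergence
    {n : ℕ} (hn : 1 ≤ n) {T : ℝ} (hT : 0 < T)
    (f : ℝ → EuclideanSpace ℝ (Fin n) → ℝ)
    (hf : ContDiffOn ℝ 3 (Function.uncurry f)
      (Set.Icc 0 T ×ˢ (Set.univ : Set (EuclideanSpace ℝ (Fin n)))))
    {a₀ c₀ : ℝ} (ha₀ : 0 ≤ a₀) (hc₀ : 0 < c₀)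
    (hA1 : ∀ t ∈ Set.Icc (0:ℝ) T, ∀ x : EuclideanSpace ℝ (Fin n),
      ⟪gradient (f t) x, x⟫ ≥ c₀ * ‖x‖ ^ 2 - a₀)
    (hA2 : ∀ p ∈ degenerateCriticalSet T f, HessPosSemidef f p.1 p.2 →
      ∃ ℓ : EuclideanSpace ℝ (Fin n), ℓ ≠ 0 ∧
        LinearMap.ker ((fderiv ℝ (gradient (f p.1)) p.2 :
          EuclideanSpace ℝ (Fin n) →L[ℝ] EuclideanSpace ℝ (Fin n)) :
          EuclideanSpace ℝ (Fin n) →ₗ[ℝ] EuclideanSpace ℝ (Fin n)) = Submodule.span ℝ {ℓ} ∧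
        ⟪gradft f p.1 p.2, ℓ⟫ ≠ 0 ∧ thirdDeriv f p.1 p.2 ℓ ≠ 0)
    (hA3fin : (degenerateCriticalSet T f).Finite)
    (hA3inj : ∀ p ∈ degenerateCriticalSet T f, ∀ q ∈ degenerateCriticalSet T f,
      p.1 = q.1 → p = q)
    (hA3end : ∀ p ∈ degenerateCriticalSet T f, p.1 ≠ 0 ∧ p.1 ≠ T)
    (hA4 : ∀ p ∈ degenerateCriticalSet T f, HessPosSemidef f p.1 p.2 →
      ∀ w : ℝ → EuclideanSpace ℝ (Fin n),
        (∀ s : ℝ, HasDerivAt w (-(gradient (f p.1) (w s))) s) →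
        Tendsto w atBot (nhds p.2) → (∃ s₁ s₂ : ℝ, w s₁ ≠ w s₂) →
        ∃ wlim : EuclideanSpace ℝ (Fin n),
          Tendsto w atTop (nhds wlim) ∧ HessPosDef f p.1 wlim)
    (y₀ : EuclideanSpace ℝ (Fin n))
    (hy₀ : gradient (f 0) y₀ = 0) (hy₀pd : HessPosDef f 0 y₀)
    (k : ℕ) (hk : 1 ≤ k) (t : ℕ → ℝ)
    (ht0 : t 0 = 0) (htk : t k = T) (htmono : ∀ i < k, t i < t (i + 1))
    (ui vi : ℕ → ℝ → EuclideanSpace ℝ (Fin n))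
    (x y : ℕ → EuclideanSpace ℝ (Fin n))
    (hu1 : ui 1 0 = y₀)
    (huiC2 : ∀ i, 1 ≤ i → i ≤ k → ContDiffOn ℝ 2 (ui i) (Set.Ico (t (i - 1)) (t i)))
    (huicrit : ∀ i, 1 ≤ i → i ≤ k → ∀ s ∈ Set.Ico (t (i - 1)) (t i),
      gradient (f s) (ui i s) = 0 ∧ HessPosDef f s (ui i s))
    (hx : ∀ i, 1 ≤ i → i ≤ k →
      Tendsto (ui i) (nhdsWithin (t i) (Set.Iio (t i))) (nhds (x i)))
    (hxdeg : ∀ i, 1 ≤ i → i ≤ k - 1 →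
      (t i, x i) ∈ degenerateCriticalSet T f ∧ HessPosSemidef f (t i) (x i))
    (hy : ∀ i, 1 ≤ i → i ≤ k - 1 → y i = ui (i + 1) (t i))
    (hviC2 : ∀ i, 1 ≤ i → i ≤ k - 1 → ContDiff ℝ 2 (vi i))
    (hvinc : ∀ i, 1 ≤ i → i ≤ k - 1 → ∃ s₁ s₂ : ℝ, vi i s₁ ≠ vi i s₂)
    (hvode : ∀ i, 1 ≤ i → i ≤ k - 1 →
      ∀ s : ℝ, HasDerivAt (vi i) (-(gradient (f (t i)) (vi i s))) s)
    (hvlim : ∀ i, 1 ≤ i → i ≤ k - 1 →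
      Tendsto (vi i) atBot (nhds (x i)) ∧ Tendsto (vi i) atTop (nhds (y i)))
    (u : ℝ → EuclideanSpace ℝ (Fin n))
    (hupiece : ∀ i, 1 ≤ i → i ≤ k → ∀ s ∈ Set.Ico (t (i - 1)) (t i), u s = ui i s)
    (huT : u T = x k)
    (uε : ℝ → ℝ → EuclideanSpace ℝ (Fin n)) (yε : ℝ → EuclideanSpace ℝ (Fin n))
    (hode : ∀ ε : ℝ, 0 < ε → ∀ s ∈ Set.Icc (0:ℝ) T,
      HasDerivWithinAt (uε ε) (-(ε⁻¹ • gradient (f s) (uε ε s))) (Set.Icc 0 T) s)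
    (hinit : ∀ ε : ℝ, 0 < ε → uε ε 0 = yε ε)
    (hyε : Tendsto yε (nhdsWithin 0 (Set.Ioi 0)) (nhds y₀)) :
    ∀ K : Set ℝ, K ⊆ Set.Icc 0 T → (∀ i, 1 ≤ i → i ≤ k - 1 → t i ∉ K) →
      IsCompact K →
      TendstoUniformlyOn (fun ε s => uε ε s) u (nhdsWithin 0 (Set.Ioi 0)) K := by
  have hg := contDiffOn_uncurry_gradient hT hf
  have hmono : ∀ i j, i ≤ j → j ≤ k → t i ≤ t j := by
    intro i j hij
    induction j, hij using Nat.le_induction with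
    | base => exact fun _ => le_rfl
    | succ j _ ih => exact fun hj => (ih (by omega)).trans (htmono j (by omega)).le
  have hpos : ∀ i ≤ k, 0 ≤ t i := fun i hi => ht0 ▸ hmono 0 i (Nat.zero_le i) hi
  have hleT : ∀ i ≤ k, t i ≤ T := fun i hi => htk ▸ hmono i k hi le_rfl
  have hlt : ∀ i, 1 ≤ i → i ≤ k → t (i - 1) < t i := fun i hi hik => by
    have := htmono (i - 1) (by omega)
    rwa [Nat.sub_add_cancel hi] at this
  have hsol : ∀ ε > 0, IsFastSol (fun t x => gradient (f t) x) T ε (uε ε) := hode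
  have hbranch : ∀ i, 1 ≤ i → i ≤ k →
      IsStableBranch (fun t x => gradient (f t) x) (t (i - 1)) (t i) u := fun i hi hik =>
    ⟨(huiC2 i hi hik).congr (hupiece i hi hik),
      fun s hs => by rw [hupiece i hi hik s hs]; exact (huicrit i hi hik s hs).1,
      fun s hs => by rw [hupiece i hi hik s hs]; exact (huicrit i hi hik s hs).2⟩
  have hlim : ∀ i, 1 ≤ i → i ≤ k → Tendsto u (𝓝[<] (t i)) (𝓝 (x i)) := fun i hi hik =>
    (hx i hi hik).congr' (mem_of_superset (Ico_mem_nhdsLT (hlt i hi hik)) fun s hs =>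
      (hupiece i hi hik s hs).symm)
  have hstart : ∀ ρ > 0, ∀ᶠ ε in 𝓝[>] (0 : ℝ), ‖uε ε 0 - y₀‖ ≤ ρ := by
    intro ρ hρ
    filter_upwards [self_mem_nhdsWithin, hyε.eventually (Metric.closedBall_mem_nhds y₀ hρ)]
      with ε hε h
    rwa [hinit ε hε, ← dist_eq_norm]
  have hu0 : u 0 = y₀ := by
    rw [← hu1]
    exact hupiece 1 le_rfl hk 0 (by
      have := hlt 1 le_rfl hk
      simp only [Nat.sub_self, ht0] at this ⊢
      exact ⟨le_rfl, this⟩)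
  obtain ⟨R₀, hR₀⟩ := exists_bound_of_coercive ha₀ hc₀ hA1 (‖y₀‖ + 1)
  have hbd : ∀ R ≥ R₀, ∀ᶠ ε in 𝓝[>] (0 : ℝ), ∀ s ∈ Icc 0 T, uε ε s ∈ Metric.closedBall 0 R := by
    intro R hR
    filter_upwards [self_mem_nhdsWithin, hstart 1 one_pos] with ε hε h
    refine hR₀ R hR ε hε (uε ε) (hsol ε hε) ?_
    linarith [norm_le_norm_add_norm_sub' (uε ε 0) y₀]
  have hinitial : ∀ b < t 1, ∀ ρ > 0, ∀ᶠ ε in 𝓝[>] (0 : ℝ), ∀ s ∈ Icc 0 b,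
      ‖uε ε s - u s‖ ≤ ρ := by
    intro b hb ρ hρ
    rcases lt_or_ge b 0 with hb0 | hb0
    · exact Eventually.of_forall fun ε s hs => absurd (hs.1.trans hs.2) (not_le.2 hb0)
    have hbr := hbranch 1 le_rfl hk
    simp only [Nat.sub_self, ht0] at hbr
    obtain ⟨ρ', hρ', h⟩ := hbr.exists_follow hT hg le_rfl (hleT 1 hk) hsol hb hρ
    exact h 0 ⟨le_rfl, hb0⟩ (by rw [hu0]; exact hstart ρ' hρ')
  have hconv : ∀ i, 1 ≤ i → i ≤ k → ∀ a b, t (i - 1) < a → b < t i → ∀ ρ > 0,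
      ∀ᶠ ε in 𝓝[>] (0 : ℝ), ∀ s ∈ Icc a b, ‖uε ε s - u s‖ ≤ ρ := by
    intro i hi
    induction i, hi using Nat.le_induction with
    | base =>
      intro _ a b ha hb ρ hρ
      simp only [Nat.sub_self, ht0] at ha
      exact (hinitial b hb ρ hρ).mono fun ε hε s hs => hε s ⟨ha.le.trans hs.1, hs.2⟩
    | succ i hi ih =>
      intro hik a b ha hb ρ hρ
      have hik' : i ≤ k - 1 := by omega
      obtain ⟨hdeg, hpsd⟩ := hxdeg i hi hik'
      obtain ⟨ℓ₀, hℓ₀, hker, hβ, hcubic⟩ := hA2 _ hdeg hpsd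
      have hτ : t i ∈ Ioo 0 T := ⟨lt_of_le_of_ne hdeg.1.1 (hA3end _ hdeg).1.symm,
        lt_of_le_of_ne hdeg.1.2 (hA3end _ hdeg).2⟩
      obtain ⟨ℓ, κ, r, δ₀, c₁, C₁, c, C, β, S⟩ :=
        exists_saddleNode_gradient hT hf hτ hdeg.2.1 hpsd hℓ₀ hker hβ hcubic
      have hbr := hbranch (i + 1) (by omega) hik
      rw [Nat.add_sub_cancel] at hbr ha
      have hti : t i ∈ Ico (t i) (t (i + 1)) := ⟨le_rfl, htmono i (by omega)⟩
      have hyu : y i = u (t i) := by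
        rw [hy i hi hik']
        exact (hupiece (i + 1) (by omega) hik (t i) (by rwa [Nat.add_sub_cancel])).symm
      refine hbr.eventually_norm_sub_le hT hg hτ.1.le hti.2 (hleT _ hik) hsol (fun ρ' hρ' => ?_)
        ha hb hρ
      refine S.exists_eventually_near_endpoint hg (hlim i hi (by omega))
        (mem_of_superset (Ico_mem_nhdsLT (hlt i hi (by omega))) (hbranch i hi (by omega)).crit)
        (hvode i hi hik') (hvinc i hi hik') (hvlim i hi hik').1 (hyu ▸ (hvlim i hi hik').2)
        (hbr.crit _ hti) (hbr.posDef _ hti) hsol hbd (hlt i hi (by omega)) (ih (by omega)) hρ'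
  have hfinal : ∀ ρ > 0, ∃ a < T, ∀ᶠ ε in 𝓝[>] (0 : ℝ), ∀ s ∈ Icc a T, ‖uε ε s - u s‖ ≤ ρ := by
    intro ρ hρ
    have hbr := hbranch k hk le_rfl
    have hlimT := hlim k hk le_rfl
    have hltT := hlt k hk le_rfl
    have hconvT := hconv k hk le_rfl
    rw [htk] at hbr hlimT hltT hconvT
    have hp := hpos (k - 1) (by omega)
    obtain ⟨hcrit, hpd⟩ := crit_and_posDef_of_tendsto hT hf hp hltT hbr hlimT
      fun h hdet => (hA3end (T, x k) ⟨right_mem_Icc.2 hT.le, h, hdet⟩).2 rfl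
    exact exists_eventually_norm_sub_le_endpoint hT hg hsol hcrit hpd hlimT huT hp hltT hconvT hρ
  have hcover : ∀ j ≤ k, ∀ s, 0 ≤ s → s < t j → ∃ i, 1 ≤ i ∧ i ≤ j ∧ s ∈ Ico (t (i - 1)) (t i) := by
    intro j
    induction j with
    | zero => exact fun _ s hs hs' => absurd hs' (by rw [ht0]; exact not_lt.2 hs)
    | succ j ih =>
      intro hj s hs hs'
      rcases lt_or_ge s (t j) with h | h
      · obtain ⟨i, hi, hij, his⟩ := ih (by omega) s hs h
        exact ⟨i, hi, by omega, his⟩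
      · exact ⟨j + 1, by omega, le_rfl, by simpa using h, hs'⟩
  intro K hK hKt hKc
  rw [← tendstoLocallyUniformlyOn_iff_tendstoUniformlyOn_of_compact hKc,
    Metric.tendstoLocallyUniformlyOn_iff]
  intro η hη s hs
  have hnorm : ∀ V : Set ℝ, (∀ᶠ ε in 𝓝[>] (0 : ℝ), ∀ s ∈ V, ‖uε ε s - u s‖ ≤ η / 2) →
      ∀ᶠ ε in 𝓝[>] (0 : ℝ), ∀ s ∈ V, dist (u s) (uε ε s) < η := fun V h =>
    h.mono fun ε hε s hs => by
      rw [dist_comm, dist_eq_norm]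
      exact (hε s hs).trans_lt (half_lt_self hη)
  rcases (hK hs).2.eq_or_lt with rfl | hsT
  · obtain ⟨a, ha, h⟩ := hfinal (η / 2) (half_pos hη)
    exact ⟨Icc a s, mem_of_superset (inter_mem_nhdsWithin K (Ioi_mem_nhds ha)) fun z hz =>
      ⟨hz.2.le, (hK hz.1).2⟩, hnorm _ h⟩
  obtain ⟨i, hi, hik, his⟩ := hcover k le_rfl s (hK hs).1 (by rwa [htk])
  obtain ⟨b, hsb, hb⟩ := exists_between his.2
  rcases his.1.eq_or_lt with hsi | hsi
  · have hi1 : i = 1 := by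
      by_contra hne
      exact hKt (i - 1) (by omega) (by omega) (hsi ▸ hs)
    subst hi1
    exact ⟨Icc 0 b, mem_of_superset (inter_mem_nhdsWithin K (Iio_mem_nhds hsb)) fun z hz =>
      ⟨(hK hz.1).1, hz.2.le⟩, hnorm _ (hinitial b hb _ (half_pos hη))⟩
  · obtain ⟨a, hsa, has⟩ := exists_between hsi
    exact ⟨Icc a b, mem_nhdsWithin_of_mem_nhds (Icc_mem_nhds has hsb),
      hnorm _ (hconv i hi hik a b hsa hb _ (half_pos hη))⟩
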